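/- arXiv:2106.08583 — 2 statements merged into one kernel-verified Lean document; each statement's English description precedes it below -/
import Mathlib

section
/- Let R be a d-dimensional Cohen–Macaulay local ring with a canonical module ω. Let M, N be finitely generated R-modules with N maximal Cohen–Macaulay. If Ext^i_R(M, N) = 0 for all 1 ≤ i ≤ d, then M ⊗_R Hom_R(N, ω) is a maximal Cohen–Macaulay R-module. -/
open CategoryTheory TensorProduct IsLocalRing

noncomputable section

/-- The `n`-th Ext group of two `R`-modules. -/
abbrev extGroup (R : Type) [CommRing R] (n : ℕ) (M N : Type) [AddCommGroup M] [Module R M]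
    [AddCommGroup N] [Module R N] : Type :=
  ((Ext R (ModuleCat R) n).obj (Opposite.op (ModuleCat.of R M))).obj (ModuleCat.of R N)

/-- The `n`-th Tor group of two `R`-modules. -/
abbrev torGroup (R : Type) [CommRing R] (n : ℕ) (M N : Type) [AddCommGroup M] [Module R M]
    [AddCommGroup N] [Module R N] : Type :=
  ((Tor (ModuleCat R) n).obj (ModuleCat.of R M)).obj (ModuleCat.of R N)

/-- The depth of a module over a local ring, as the infimum of the degrees in which
`Ext(k, N)` is nonzero. -/
def moduleDepth (R : Type) [CommRing R] [IsLocalRing R] (N : Type) [AddCommGroup N]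
    [Module R N] : ℕ∞ :=
  sInf {n : ℕ∞ | ∃ k : ℕ, n = k ∧
    Nontrivial (extGroup R k (R ⧸ IsLocalRing.maximalIdeal R) N)}

/-- A module is maximal Cohen–Macaulay if `depth M_p = dim R_p` for all `p` in the support. -/
def IsMCM (R : Type) [CommRing R] (M : Type) [AddCommGroup M] [Module R M] : Prop :=
  ∀ p : PrimeSpectrum R, Nontrivial (LocalizedModule p.asIdeal.primeCompl M) →
    (moduleDepth (Localization.AtPrime p.asIdeal)
        (LocalizedModule p.asIdeal.primeCompl M) : WithBot ℕ∞) =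
      ringKrullDim (Localization.AtPrime p.asIdeal)

/-- A local ring is Cohen–Macaulay if its depth equals its Krull dimension. -/
def IsCMLocal (R : Type) [CommRing R] [IsLocalRing R] : Prop :=
  (moduleDepth R R : WithBot ℕ∞) = ringKrullDim R

/-- Injective dimension at most `n`, defined recursively via cosyzygies. -/
def hasInjDimLE (R : Type) [CommRing R] : ℕ → ∀ (M : Type) [AddCommGroup M] [Module R M], Prop
  | 0, M, _, _ => Module.Injective R M
  | (n+1), M, _, _ => ∃ (I : Type) (_ : AddCommGroup I) (_ : Module R I) (f : M →ₗ[R] I),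
      Module.Injective R I ∧ Function.Injective f ∧
        hasInjDimLE R n (I ⧸ LinearMap.range f)

/-- Projective dimension at most `n`, defined recursively via syzygies. -/
def hasPdLE (R : Type) [CommRing R] : ℕ → ∀ (M : Type) [AddCommGroup M] [Module R M], Prop
  | 0, M, _, _ => Module.Projective R M
  | (n+1), M, _, _ => ∃ (P : Type) (_ : AddCommGroup P) (_ : Module R P) (f : P →ₗ[R] M),
      Module.Projective R P ∧ Function.Surjective f ∧ hasPdLE R n (LinearMap.ker f)

/-- `ω` is a canonical module of the Cohen–Macaulay local ring `R`: it is finitely generated,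
maximal Cohen–Macaulay, of finite injective dimension, and of type one. -/
def IsCanonicalModule (R : Type) [CommRing R] [IsLocalRing R] (ω : Type) [AddCommGroup ω]
    [Module R ω] : Prop :=
  Module.Finite R ω ∧ IsMCM R ω ∧ (∃ n, hasInjDimLE R n ω) ∧
    ∃ d : ℕ, ringKrullDim R = d ∧
      Nonempty (extGroup R d (R ⧸ IsLocalRing.maximalIdeal R) ω ≃ₗ[R]
        (R ⧸ IsLocalRing.maximalIdeal R))

/-- `T` is an Auslander transpose of `M`: the cokernel of the `R`-dual of a minimal
free presentation of `M`. -/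
def IsAuslanderTranspose (R : Type) [CommRing R] [IsLocalRing R] (M T : Type)
    [AddCommGroup M] [Module R M] [AddCommGroup T] [Module R T] : Prop :=
  ∃ (m n : ℕ) (f : (Fin n → R) →ₗ[R] (Fin m → R)),
    LinearMap.range f ≤ (IsLocalRing.maximalIdeal R) • (⊤ : Submodule R (Fin m → R)) ∧
    LinearMap.ker f ≤ (IsLocalRing.maximalIdeal R) • (⊤ : Submodule R (Fin n → R)) ∧
    Nonempty (((Fin m → R) ⧸ LinearMap.range f) ≃ₗ[R] M) ∧
    Nonempty ((Module.Dual R (Fin n → R) ⧸ LinearMap.range f.dualMap) ≃ₗ[R] T)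

end

section ExtVanishing

/-- Vanishing of the `n`-th Ext group of two modules. -/
abbrev ExtZero (R : Type) [CommRing R] (n : ℕ) (M N : Type) [AddCommGroup M] [Module R M]
    [AddCommGroup N] [Module R N] : Prop :=
  Subsingleton (Abelian.Ext.{0} (ModuleCat.of R M) (ModuleCat.of R N) n)

variable {R : Type} [CommRing R] {A B C X Y : Type}
  [AddCommGroup A] [Module R A] [AddCommGroup B] [Module R B] [AddCommGroup C] [Module R C]
  [AddCommGroup X] [Module R X] [AddCommGroup Y] [Module R Y]

theorem subsingleton_extGroup_iff (n : ℕ) :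
    Subsingleton (extGroup R n X Y) ↔ ExtZero R n X Y := by
  let P := ProjectiveResolution.of (ModuleCat.of R X)
  have h1 : Subsingleton (extGroup R n X Y) ↔
      (P.complex.linearYonedaObj R (ModuleCat.of R Y)).ExactAt n := by
    rw [HomologicalComplex.exactAt_iff_isZero_homology,
      ← (P.isoExt (R := R) n (ModuleCat.of R Y)).isZero_iff, ModuleCat.isZero_iff_subsingleton]
  rw [h1]
  cases n with
  | zero =>
    rw [HomologicalComplex.exactAt_iff' _ 0 0 1 CochainComplex.prev_nat_zero (by simp),
      ShortComplex.moduleCat_exact_iff]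
    have hz : ((P.complex.linearYonedaObj R (ModuleCat.of R Y)).sc' 0 0 1).f = 0 :=
      (P.complex.linearYonedaObj R (ModuleCat.of R Y)).shape 0 0 (by decide)
    constructor
    · intro h
      have : ∀ g : ((ChainComplex.single₀ (ModuleCat R)).obj (ModuleCat.of R X)).X 0 ⟶
          ModuleCat.of R Y, g = 0 := by
        intro g
        obtain ⟨y, hy⟩ := h (P.π.f 0 ≫ g) (by
          change P.complex.d 1 0 ≫ P.π.f 0 ≫ g = 0
          rw [← Category.assoc, P.complex_d_comp_π_f_zero, Limits.zero_comp])
        rw [hz] at hy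
        have h2 : P.π.f 0 ≫ g = 0 := hy.symm
        rw [← cancel_epi (P.π.f 0), h2, Limits.comp_zero]
      refine ⟨fun a b => ?_⟩
      obtain ⟨a, rfl⟩ := Abelian.Ext.addEquiv₀.symm.surjective a
      obtain ⟨b, rfl⟩ := Abelian.Ext.addEquiv₀.symm.surjective b
      exact congrArg _ ((this a).trans (this b).symm)
    · intro h x hx
      have hx' : P.complex.d 1 0 ≫ x = 0 := hx
      refine ⟨0, ?_⟩
      rw [map_zero]
      obtain ⟨l, hl⟩ := P.exact₀.desc' (k := x) hx'
      have h3 : l = 0 := Abelian.Ext.addEquiv₀.symm.injective (h.elim _ _)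
      rw [h3, Limits.comp_zero] at hl
      exact hl
  | succ n =>
    rw [HomologicalComplex.exactAt_iff' _ n (n + 1) (n + 2) (by simp) (by simp),
      ShortComplex.moduleCat_exact_iff]
    constructor
    · intro h
      refine subsingleton_of_forall_eq 0 fun a => ?_
      obtain ⟨f, hf, rfl⟩ := P.extMk_surjective a (n + 2) rfl
      rw [P.extMk_eq_zero_iff _ _ _ _ n rfl]
      exact h f hf
    · intro h x hx
      exact (P.extMk_eq_zero_iff x (n + 2) rfl hx n rfl).1 (Subsingleton.elim _ _)

theorem ExtZero.zero_iff : ExtZero R 0 X Y ↔ Subsingleton (X →ₗ[R] Y) :=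
  (Abelian.Ext.addEquiv₀.trans ModuleCat.homAddEquiv).toEquiv.subsingleton_congr

variable {f : A →ₗ[R] B} {g : B →ₗ[R] C}

theorem shortExact_of (hf : Function.Injective f) (hfg : Function.Exact f g)
    (hg : Function.Surjective g) :
    (ModuleCat.shortComplexOfCompEqZero f g hfg.linearMap_comp_eq_zero).ShortExact :=
  ModuleCat.shortComplex_shortExact _ hfg hf hg

section
variable (hf : Function.Injective f) (hfg : Function.Exact f g) (hg : Function.Surjective g)
include hf hfg hg

theorem ExtZero.cov_left {n : ℕ} (hC : ExtZero R n X C) (hB : ExtZero R (n + 1) X B) :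
    ExtZero R (n + 1) X A :=
  subsingleton_of_forall_eq 0 fun x => by
    obtain ⟨y, rfl⟩ := Abelian.Ext.covariant_sequence_exact₁ (ModuleCat.of R X)
      (shortExact_of hf hfg hg) x (hB.elim _ _) rfl
    rw [hC.elim y 0, Abelian.Ext.zero_comp]

theorem ExtZero.cov_middle {n : ℕ} (hA : ExtZero R n X A) (hC : ExtZero R n X C) :
    ExtZero R n X B :=
  subsingleton_of_forall_eq 0 fun x => by
    obtain ⟨y, rfl⟩ := Abelian.Ext.covariant_sequence_exact₂ (ModuleCat.of R X)
      (shortExact_of hf hfg hg) x (hC.elim _ _)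
    rw [hA.elim y 0, Abelian.Ext.zero_comp]

theorem ExtZero.cov_right {n : ℕ} (hB : ExtZero R n X B) (hA : ExtZero R (n + 1) X A) :
    ExtZero R n X C :=
  subsingleton_of_forall_eq 0 fun x => by
    obtain ⟨y, rfl⟩ := Abelian.Ext.covariant_sequence_exact₃ (ModuleCat.of R X)
      (shortExact_of hf hfg hg) x rfl (hA.elim _ _)
    rw [hB.elim y 0, Abelian.Ext.zero_comp]

theorem ExtZero.contra_left {n : ℕ} (hB : ExtZero R n B Y) (hC : ExtZero R (n + 1) C Y) :
    ExtZero R n A Y :=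
  subsingleton_of_forall_eq 0 fun x => by
    obtain ⟨y, rfl⟩ := Abelian.Ext.contravariant_sequence_exact₁
      (shortExact_of hf hfg hg) (ModuleCat.of R Y) x (add_comm 1 n) (hC.elim _ _)
    rw [hB.elim y 0, Abelian.Ext.comp_zero]

theorem ExtZero.contra_middle {n : ℕ} (hA : ExtZero R n A Y) (hC : ExtZero R n C Y) :
    ExtZero R n B Y :=
  subsingleton_of_forall_eq 0 fun x => by
    obtain ⟨y, rfl⟩ := Abelian.Ext.contravariant_sequence_exact₂
      (shortExact_of hf hfg hg) (ModuleCat.of R Y) x (hA.elim _ _)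
    rw [hC.elim y 0, Abelian.Ext.comp_zero]

theorem ExtZero.contra_right {n : ℕ} (hA : ExtZero R n A Y) (hB : ExtZero R (n + 1) B Y) :
    ExtZero R (n + 1) C Y :=
  subsingleton_of_forall_eq 0 fun x => by
    obtain ⟨y, rfl⟩ := Abelian.Ext.contravariant_sequence_exact₃
      (shortExact_of hf hfg hg) (ModuleCat.of R Y) x (hB.elim _ _) (add_comm 1 n)
    rw [hA.elim y 0, Abelian.Ext.comp_zero]

theorem ExtZero.exists_extension (hC : ExtZero R 1 C Y) (φ : A →ₗ[R] Y) :
    ∃ ψ : B →ₗ[R] Y, ψ ∘ₗ f = φ := by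
  obtain ⟨y, hy⟩ := Abelian.Ext.contravariant_sequence_exact₁
      (shortExact_of hf hfg hg) (ModuleCat.of R Y) (Abelian.Ext.mk₀ (ModuleCat.ofHom φ))
      (add_comm 1 0) (hC.elim _ _)
  obtain ⟨ψ, rfl⟩ := Abelian.Ext.addEquiv₀.symm.surjective y
  refine ⟨ψ.hom, ?_⟩
  rw [Abelian.Ext.addEquiv₀_symm_apply, Abelian.Ext.mk₀_comp_mk₀] at hy
  exact congrArg ModuleCat.Hom.hom ((Abelian.Ext.mk₀_bijective _ _).1 hy)

end

theorem ExtZero.of_subsingleton_right [Subsingleton Y] (n : ℕ) : ExtZero R n X Y :=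
  subsingleton_of_forall_eq 0 fun x => by
    have h : 𝟙 (ModuleCat.of R Y) = 0 := (ModuleCat.isZero_of_subsingleton _).eq_of_src _ _
    rw [← Abelian.Ext.comp_mk₀_id x, h, Abelian.Ext.mk₀_zero, Abelian.Ext.comp_zero]

theorem ExtZero.of_subsingleton_left [Subsingleton X] (n : ℕ) : ExtZero R n X Y :=
  subsingleton_of_forall_eq 0 fun x => by
    have h : 𝟙 (ModuleCat.of R X) = 0 := (ModuleCat.isZero_of_subsingleton _).eq_of_src _ _
    rw [← Abelian.Ext.mk₀_id_comp x, h, Abelian.Ext.mk₀_zero, Abelian.Ext.zero_comp]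

theorem ExtZero.congr_right (e : A ≃ₗ[R] B) {n : ℕ} (h : ExtZero R n X A) : ExtZero R n X B :=
  ExtZero.cov_middle (g := (0 : B →ₗ[R] PUnit.{1})) e.injective
    ((LinearMap.exact_zero_iff_surjective _ _).2 e.surjective)
    (Function.surjective_to_subsingleton _) h (ExtZero.of_subsingleton_right n)

theorem ExtZero.congr_left (e : A ≃ₗ[R] B) {n : ℕ} (h : ExtZero R n A Y) : ExtZero R n B Y :=
  ExtZero.contra_middle (g := (0 : B →ₗ[R] PUnit.{1})) e.injective
    ((LinearMap.exact_zero_iff_surjective _ _).2 e.surjective)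
    (Function.surjective_to_subsingleton _) h (ExtZero.of_subsingleton_left n)

theorem ExtZero.of_projective [Module.Projective R X] (n : ℕ) : ExtZero R (n + 1) X Y :=
  have := ModuleCat.projective_of_module_projective (ModuleCat.of R X)
  Abelian.Ext.subsingleton_of_projective _ _ n

theorem ExtZero.of_injective [Module.Injective R Y] (n : ℕ) : ExtZero R (n + 1) X Y :=
  have := Module.injective_object_of_injective_module R Y
  Abelian.Ext.subsingleton_of_injective _ _ n

theorem hasInjDimLE.extZero {n : ℕ} (h : hasInjDimLE R n Y) {i : ℕ} (hi : n < i) :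
    ExtZero R i X Y := by
  induction n generalizing Y i with
  | zero =>
    obtain ⟨i, rfl⟩ := Nat.exists_eq_succ_of_ne_zero hi.ne'
    have : Module.Injective R Y := h
    exact ExtZero.of_injective i
  | succ n ih =>
    obtain ⟨I, _, _, f, hI, hf, h⟩ := h
    obtain ⟨i, rfl⟩ := Nat.exists_eq_succ_of_ne_zero (Nat.ne_zero_of_lt hi)
    exact ExtZero.cov_left hf (LinearMap.exact_map_mkQ_range f) (Submodule.mkQ_surjective _)
      (ih h (by omega)) (ExtZero.of_injective i)

end ExtVanishing

section Depth

/-- `DepthGE S t X` says that `Ext^i(k, X) = 0` for all `i < t`. -/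
def DepthGE (S : Type) [CommRing S] [IsLocalRing S] (t : ℕ) (X : Type) [AddCommGroup X]
    [Module S X] : Prop :=
  ∀ i < t, ExtZero S i (S ⧸ maximalIdeal S) X

variable {S : Type} [CommRing S] [IsLocalRing S] {A B C X Y : Type}
  [AddCommGroup A] [Module S A] [AddCommGroup B] [Module S B] [AddCommGroup C] [Module S C]
  [AddCommGroup X] [Module S X] [AddCommGroup Y] [Module S Y]

theorem DepthGE.zero : DepthGE S 0 X := fun _ h => absurd h (Nat.not_lt_zero _)

theorem DepthGE.mono {s t : ℕ} (h : s ≤ t) (H : DepthGE S t X) : DepthGE S s X :=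
  fun i hi => H i (hi.trans_le h)

theorem DepthGE.congr (e : X ≃ₗ[S] Y) {t : ℕ} (H : DepthGE S t X) : DepthGE S t Y :=
  fun i hi => (H i hi).congr_right e

theorem DepthGE.of_subsingleton [Subsingleton X] (t : ℕ) : DepthGE S t X :=
  fun i _ => ExtZero.of_subsingleton_right i

theorem DepthGE.left {f : A →ₗ[S] B} {g : B →ₗ[S] C} (hf : Function.Injective f)
    (hfg : Function.Exact f g) (hg : Function.Surjective g) {t : ℕ}
    (hB : DepthGE S (t + 1) B) (hC : DepthGE S t C) : DepthGE S (t + 1) A := by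
  rintro (_ | i) hi
  · have := ExtZero.zero_iff.1 (hB 0 hi)
    refine ExtZero.zero_iff.2 ⟨fun a b => LinearMap.ext fun z => hf ?_⟩
    exact LinearMap.congr_fun (this.elim (f ∘ₗ a) (f ∘ₗ b)) z
  · exact ExtZero.cov_left hf hfg hg (hC i (by omega)) (hB _ hi)

theorem DepthGE.middle {f : A →ₗ[S] B} {g : B →ₗ[S] C} (hf : Function.Injective f)
    (hfg : Function.Exact f g) (hg : Function.Surjective g) {t : ℕ}
    (hA : DepthGE S t A) (hC : DepthGE S t C) : DepthGE S t B :=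
  fun i hi => ExtZero.cov_middle hf hfg hg (hA i hi) (hC i hi)

theorem le_moduleDepth_iff (t : ℕ) : (t : ℕ∞) ≤ moduleDepth S X ↔ DepthGE S t X := by
  unfold moduleDepth DepthGE
  rw [le_sInf_iff]
  constructor
  · intro h i hi
    rw [← subsingleton_extGroup_iff, ← not_nontrivial_iff_subsingleton]
    intro hn
    exact absurd (h i ⟨i, rfl, hn⟩) (by simpa using hi)
  · rintro h _ ⟨i, rfl, hn⟩
    by_contra hlt
    have := (subsingleton_extGroup_iff i).2 (h i (by simpa using hlt))
    exact not_subsingleton _ this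

theorem DepthGE.quotSMulTop {x : S} (hx : IsSMulRegular X x) {t : ℕ}
    (H : DepthGE S (t + 1) X) : DepthGE S t (QuotSMulTop x X) :=
  fun i hi => ExtZero.cov_right (f := LinearMap.lsmul S X x) hx (LinearMap.exact_lsmul_mkQ_smul_top X x)
    (Submodule.mkQ_surjective _) (H i (by omega)) (H (i + 1) (by omega))

variable [IsNoetherianRing S]

theorem DepthGE.exists_regular [Module.Finite S X] {t : ℕ} (H : DepthGE S (t + 1) X) :
    ∃ x ∈ maximalIdeal S, IsSMulRegular X x := by
  have := IsSMulRegular.subsingleton_linearMap_iff.1 (ExtZero.zero_iff.1 (H 0 (Nat.succ_pos _)))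
  rwa [Ideal.annihilator_quotient] at this

theorem ExtZero.of_quotSMulTop [Module.Finite S X] [Module.Finite S Y] {x : S}
    (hm : x ∈ maximalIdeal S) (hx : IsSMulRegular X x) {n : ℕ}
    (h : ExtZero S (n + 1) (QuotSMulTop x X) Y) : ExtZero S n X Y := by
  have hfin := ModuleCat.finite_ext S (ModuleCat.of S X) (ModuleCat.of S Y) n
  have key : (⊤ : Submodule S (Abelian.Ext.{0} (ModuleCat.of S X) (ModuleCat.of S Y) n)) ≤
      maximalIdeal S • ⊤ := by
    rintro e -
    have hx' : IsSMulRegular (ModuleCat.of S X) x := hx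
    obtain ⟨e', he⟩ := Abelian.Ext.contravariant_sequence_exact₁
      hx'.smulShortComplex_shortExact (ModuleCat.of S Y) e (add_comm 1 n)
      (Subsingleton.elim (h := h) _ _)
    have he' : (Abelian.Ext.mk₀ (x • 𝟙 (ModuleCat.of S X))).comp
        (show Abelian.Ext.{0} (ModuleCat.of S X) (ModuleCat.of S Y) n from e') (zero_add n) = e :=
      he
    rw [Abelian.Ext.mk₀_smul, Abelian.Ext.smul_comp, Abelian.Ext.mk₀_id_comp] at he'
    rw [← he']
    exact Submodule.smul_mem_smul hm trivial
  have := Submodule.eq_bot_of_le_smul_of_le_jacobson_bot (maximalIdeal S) _ hfin.fg_top key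
    (IsLocalRing.maximalIdeal_le_jacobson _)
  exact (Submodule.subsingleton_iff S).1 (subsingleton_of_bot_eq_top this.symm)

end Depth

section InjectiveDimension

variable {S : Type} [CommRing S] [IsLocalRing S] {X W : Type}
  [AddCommGroup X] [Module S X] [AddCommGroup W] [Module S W]

theorem ExtZero.succ_of_quotSMulTop {x : S} (hm : x ∈ maximalIdeal S) (hx : IsSMulRegular X x)
    {t : ℕ} (h : ExtZero S t (S ⧸ maximalIdeal S) (QuotSMulTop x X)) :
    ExtZero S (t + 1) (S ⧸ maximalIdeal S) X := by
  refine subsingleton_of_forall_eq 0 fun e => ?_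
  have hx' : IsSMulRegular (ModuleCat.of S X) x := hx
  have hz : x • 𝟙 (ModuleCat.of S (S ⧸ maximalIdeal S)) = 0 := by
    ext
    change x • (Submodule.Quotient.mk 1 : S ⧸ maximalIdeal S) = 0
    rw [← Submodule.Quotient.mk_smul, Submodule.Quotient.mk_eq_zero]
    simpa using hm
  have h0 : x • e = 0 := by
    have : (Abelian.Ext.mk₀ (x • 𝟙 (ModuleCat.of S (S ⧸ maximalIdeal S)))).comp e
        (zero_add _) = 0 := by rw [hz, Abelian.Ext.mk₀_zero, Abelian.Ext.zero_comp]
    rwa [Abelian.Ext.mk₀_smul, Abelian.Ext.smul_comp, Abelian.Ext.mk₀_id_comp] at this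
  have h1 : e.comp (Abelian.Ext.mk₀ (x • 𝟙 (ModuleCat.of S X))) (add_zero _) = 0 := by
    rw [Abelian.Ext.mk₀_smul, Abelian.Ext.comp_smul, Abelian.Ext.comp_mk₀_id, h0]
  obtain ⟨y, rfl⟩ := Abelian.Ext.covariant_sequence_exact₁ _
      hx'.smulShortComplex_shortExact e h1 rfl
  have hy : y = 0 := Subsingleton.elim (h := h) _ _
  rw [hy]
  exact Abelian.Ext.zero_comp ..

theorem injective_of_residue {φ : (S ⧸ maximalIdeal S) →ₗ[S] X} (h : φ ≠ 0) :
    Function.Injective φ := by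
  have : IsSimpleModule S (S ⧸ maximalIdeal S) := by
    rw [isSimpleModule_iff_isCoatom]
    exact (maximalIdeal.isMaximal S).out
  exact LinearMap.injective_of_ne_zero h

variable [IsNoetherianRing S]

theorem ExtZero.residue_of_depth {t : ℕ} [Module.Finite S X] {s i : ℕ}
    (hX : DepthGE S t X) (hX' : ¬ ExtZero S t (S ⧸ maximalIdeal S) X)
    (hs : ∀ j, s < j → ExtZero S j X W)
    (hall : ∀ (Y : Type) [AddCommGroup Y] [Module S Y] [Module.Finite S Y], ExtZero S (i + 1) Y W)
    (hi : s + t < i) : ExtZero S i (S ⧸ maximalIdeal S) W := by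
  induction t generalizing X s with
  | zero =>
    rw [ExtZero.zero_iff, not_subsingleton_iff_nontrivial] at hX'
    obtain ⟨φ, hφ⟩ := exists_ne (0 : (S ⧸ maximalIdeal S) →ₗ[S] X)
    exact ExtZero.contra_left (injective_of_residue hφ) (LinearMap.exact_map_mkQ_range φ)
      (Submodule.mkQ_surjective _) (hs i hi) (hall _)
  | succ t ih =>
    obtain ⟨x, hm, hx⟩ := hX.exists_regular
    refine ih (X := QuotSMulTop x X) (s := s + 1) (hX.quotSMulTop hx)
      (fun h => hX' (ExtZero.succ_of_quotSMulTop hm hx h)) (fun j hj => ?_) (by omega)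
    obtain ⟨j, rfl⟩ := Nat.exists_eq_succ_of_ne_zero (Nat.ne_zero_of_lt hj)
    exact ExtZero.contra_right (f := LinearMap.lsmul S X x) hx
      (LinearMap.exact_lsmul_mkQ_smul_top X x) (Submodule.mkQ_surjective _)
      (hs j (by omega)) (hs _ (by omega))

theorem ExtZero.of_residue [Module.Finite S W] {i : ℕ}
    (hk : ExtZero S i (S ⧸ maximalIdeal S) W)
    (hall : ∀ (Y : Type) [AddCommGroup Y] [Module S Y] [Module.Finite S Y], ExtZero S (i + 1) Y W)
    [hX : Module.Finite S X] : ExtZero S i X W := by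
  induction hX using IsNoetherianRing.induction_on_isQuotientEquivQuotientPrime S with
  | subsingleton N => exact ExtZero.of_subsingleton_left i
  | quotient N p e =>
    by_cases hp : maximalIdeal S ≤ p.asIdeal
    · have : p.asIdeal = maximalIdeal S :=
        ((maximalIdeal.isMaximal S).eq_of_le p.2.ne_top hp).symm
      rw [this] at e
      exact hk.congr_left e.symm
    · obtain ⟨x, hm, hx⟩ := Set.not_subset.1 hp
      refine ExtZero.of_quotSMulTop hm ?_ (hall _)
      rw [e.isSMulRegular_congr]
      intro a b hab
      obtain ⟨a, rfl⟩ := Ideal.Quotient.mk_surjective a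
      obtain ⟨b, rfl⟩ := Ideal.Quotient.mk_surjective b
      have : Ideal.Quotient.mk p.asIdeal (x * a) = Ideal.Quotient.mk p.asIdeal (x * b) := hab
      rw [Ideal.Quotient.eq, ← mul_sub] at this
      exact Ideal.Quotient.eq.2 ((p.2.mem_or_mem this).resolve_left hx)
  | exact N₁ N₂ N₃ f g hf hg hfg h1 h3 => exact ExtZero.contra_middle hf hfg hg h1 h3

theorem ExtZero.of_depth_lt [Module.Finite S W] {n d : ℕ} (hn : hasInjDimLE S n W)
    (hd : DepthGE S d S) (hd' : ¬ ExtZero S d (S ⧸ maximalIdeal S) S)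
    {i : ℕ} (hi : d < i) [Module.Finite S X] : ExtZero S i X W := by
  obtain ⟨m, hm⟩ : ∃ m, n < i + m := ⟨n + 1, by omega⟩
  induction m generalizing X i with
  | zero => exact hn.extZero hm
  | succ m ih =>
    have hall (Y : Type) [AddCommGroup Y] [Module S Y] [Module.Finite S Y] :
        ExtZero S (i + 1) Y W := ih (by omega) (by omega)
    refine ExtZero.of_residue (ExtZero.residue_of_depth (X := S) (s := 0) hd hd'
      (fun j hj => ?_) hall (by omega)) hall
    obtain ⟨j, rfl⟩ := Nat.exists_eq_succ_of_ne_zero hj.ne'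
    exact ExtZero.of_projective j

theorem ExtZero.of_depthGE [Module.Finite S W] {d : ℕ}
    (hW : ∀ i, d < i → ∀ (Y : Type) [AddCommGroup Y] [Module S Y] [Module.Finite S Y],
      ExtZero S i Y W) {t i : ℕ} [Module.Finite S X] (hX : DepthGE S t X) (hi : d < i + t) :
    ExtZero S i X W := by
  induction t generalizing X i with
  | zero => exact hW i hi X
  | succ t ih =>
    obtain ⟨x, hm, hx⟩ := hX.exists_regular
    exact ExtZero.of_quotSMulTop hm hx (ih (hX.quotSMulTop hx) (by omega))

end InjectiveDimension

section RegularSequence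

variable {S : Type} [CommRing S] [IsLocalRing S] {X : Type} [AddCommGroup X] [Module S X]

theorem primeCompl_maximalIdeal_le : (maximalIdeal S).primeCompl ≤ IsUnit.submonoid S :=
  fun _ hx => IsLocalRing.notMem_maximalIdeal.1 hx

theorem exists_linearEquiv_localizedModule :
    Nonempty (LocalizedModule (maximalIdeal S).primeCompl X ≃ₗ[S] X) := by
  have : IsLocalization (maximalIdeal S).primeCompl S :=
    IsLocalization.self primeCompl_maximalIdeal_le
  have := isLocalizedModule_id (maximalIdeal S).primeCompl X S
  exact ⟨IsLocalizedModule.iso (maximalIdeal S).primeCompl LinearMap.id⟩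

variable [Module.Finite S X]

theorem maximalIdeal_smul_top_lt [Nontrivial X] :
    maximalIdeal S • (⊤ : Submodule S X) < ⊤ :=
  (Submodule.top_ne_ideal_smul_of_le_jacobson_annihilator
    (maximalIdeal_le_jacobson _)).symm.lt_top

variable [IsNoetherianRing S]

theorem DepthGE.exists_isRegular [Nontrivial X] {t : ℕ} (H : DepthGE S t X) :
    ∃ rs : List S, rs.length = t ∧ (∀ r ∈ rs, r ∈ maximalIdeal S) ∧
      RingTheory.Sequence.IsRegular X rs :=
  ModuleCat.exists_isRegular_of_exists_subsingleton_ext (maximalIdeal S) t (ModuleCat.of S X)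
    maximalIdeal_smul_top_lt (ModuleCat.of S (S ⧸ maximalIdeal S))
    (by rw [Module.support_eq_zeroLocus, Ideal.annihilator_quotient]) H

theorem DepthGE.of_isRegular [Nontrivial X] {rs : List S} (hm : ∀ r ∈ rs, r ∈ maximalIdeal S)
    (H : RingTheory.Sequence.IsRegular X rs) : DepthGE S rs.length X :=
  ModuleCat.subsingleton_ext_of_exists_isRegular (maximalIdeal S)
    (ModuleCat.of S (S ⧸ maximalIdeal S))
    (by rw [Module.support_eq_zeroLocus, Ideal.annihilator_quotient]) (ModuleCat.of S X)
    maximalIdeal_smul_top_lt rs hm H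

theorem DepthGE.le_ringKrullDim [Nontrivial X] {t : ℕ} (H : DepthGE S t X) :
    (t : WithBot ℕ∞) ≤ ringKrullDim S := by
  obtain ⟨rs, rfl, hm, hrs⟩ := H.exists_isRegular
  have h := Module.supportDim_add_length_eq_supportDim_of_isRegular rs hrs
  have hnt : Nontrivial (X ⧸ Ideal.ofList rs • (⊤ : Submodule S X)) :=
    Submodule.Quotient.nontrivial_iff.2 hrs.top_ne_smul.symm
  have h0 : 0 ≤ Module.supportDim S (X ⧸ Ideal.ofList rs • (⊤ : Submodule S X)) :=
    Order.krullDim_nonneg_iff.2 (Module.nonempty_support_of_nontrivial).to_subtype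
  calc (rs.length : WithBot ℕ∞) = 0 + rs.length := (zero_add _).symm
    _ ≤ _ := by gcongr
    _ = Module.supportDim S X := h
    _ ≤ _ := Module.supportDim_le_ringKrullDim S X

theorem DepthGE.of_localizedModule {t : ℕ}
    (H : DepthGE (Localization.AtPrime (maximalIdeal S)) t
      (LocalizedModule (maximalIdeal S).primeCompl X)) : DepthGE S t X := by
  obtain ⟨e⟩ := exists_linearEquiv_localizedModule (S := S) (X := X)
  rcases subsingleton_or_nontrivial X with hX | hX
  · exact DepthGE.of_subsingleton t
  have hX' : Nontrivial (LocalizedModule (maximalIdeal S).primeCompl X) := e.toEquiv.nontrivial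
  obtain ⟨rs, rfl, hm, hrs⟩ := H.exists_isRegular
  have hsurj : Function.Surjective (algebraMap S (Localization.AtPrime (maximalIdeal S))) :=
    (IsLocalization.atUnits S (maximalIdeal S).primeCompl primeCompl_maximalIdeal_le).surjective
  obtain ⟨rs, rfl⟩ : ∃ rs' : List S, rs'.map (algebraMap S (Localization.AtPrime (maximalIdeal S))) = rs :=
    List.map_surjective_iff.2 hsurj rs
  rw [List.length_map]
  have hm' : ∀ r ∈ rs, r ∈ maximalIdeal S := fun r hr => by
    by_contra hr'
    exact (hm _ (List.mem_map_of_mem hr)) ((IsLocalRing.notMem_maximalIdeal.1 hr').map _)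
  have hw := (RingTheory.Sequence.isWeaklyRegular_map_algebraMap_iff _ _ rs).1
    hrs.toIsWeaklyRegular
  rw [e.isWeaklyRegular_congr] at hw
  exact DepthGE.of_isRegular hm' (.of_isWeaklyRegular_of_mem_maximalIdeal X hm' hw)

end RegularSequence

section DepthAt

/-- The localization `X_p` has depth at least `t` over `R_p`. -/
def DepthAt {R : Type} [CommRing R] (p : Ideal R) [p.IsPrime] (t : ℕ) (X : Type)
    [AddCommGroup X] [Module R X] : Prop :=
  DepthGE (Localization.AtPrime p) t (LocalizedModule p.primeCompl X)

variable {R : Type} [CommRing R] {p : Ideal R} [p.IsPrime] {A B C X Y : Type}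
  [AddCommGroup A] [Module R A] [AddCommGroup B] [Module R B] [AddCommGroup C] [Module R C]
  [AddCommGroup X] [Module R X] [AddCommGroup Y] [Module R Y]

theorem DepthAt.zero : DepthAt p 0 X := DepthGE.zero

theorem DepthAt.mono {s t : ℕ} (h : s ≤ t) (H : DepthAt p t X) : DepthAt p s X :=
  DepthGE.mono h H

theorem DepthAt.congr (e : X ≃ₗ[R] Y) {t : ℕ} (H : DepthAt p t X) : DepthAt p t Y :=
  DepthGE.congr (LinearEquiv.ofBijective (LocalizedModule.map p.primeCompl e.toLinearMap)
    ⟨LocalizedModule.map_injective _ _ e.injective,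
      LocalizedModule.map_surjective _ _ e.surjective⟩) H

theorem DepthAt.of_subsingleton [Subsingleton X] (t : ℕ) : DepthAt p t X :=
  have : Subsingleton (LocalizedModule p.primeCompl X) := LocalizedModule.subsingleton_iff.2
    fun _ => ⟨1, one_mem _, Subsingleton.elim _ _⟩
  DepthGE.of_subsingleton t

theorem localizedModule_map_exact {f : A →ₗ[R] B} {g : B →ₗ[R] C} (hfg : Function.Exact f g) :
    Function.Exact (LocalizedModule.map p.primeCompl f) (LocalizedModule.map p.primeCompl g) :=
  LocalizedModule.map_exact p.primeCompl f g hfg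

section
variable {f : A →ₗ[R] B} {g : B →ₗ[R] C} (hf : Function.Injective f)
  (hfg : Function.Exact f g) (hg : Function.Surjective g)
include hf hfg hg

theorem DepthAt.left {t : ℕ} (hB : DepthAt p (t + 1) B) (hC : DepthAt p t C) :
    DepthAt p (t + 1) A :=
  DepthGE.left (LocalizedModule.map_injective _ _ hf) (localizedModule_map_exact hfg)
    (LocalizedModule.map_surjective _ _ hg) hB hC

theorem DepthAt.middle {t : ℕ} (hA : DepthAt p t A) (hC : DepthAt p t C) : DepthAt p t B :=
  DepthGE.middle (LocalizedModule.map_injective _ _ hf) (localizedModule_map_exact hfg)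
    (LocalizedModule.map_surjective _ _ hg) hA hC

end

theorem DepthAt.one_of_injective {f : A →ₗ[R] B} (hf : Function.Injective f)
    (hB : DepthAt p 1 B) : DepthAt p 1 A :=
  DepthAt.left hf (LinearMap.exact_map_mkQ_range f) (Submodule.mkQ_surjective _) hB DepthGE.zero

theorem DepthAt.pi {t : ℕ} (h : DepthAt p t X) (n : ℕ) : DepthAt p t (Fin n → X) := by
  induction n with
  | zero => exact DepthAt.of_subsingleton t
  | succ n ih =>
    refine DepthAt.middle (f := LinearMap.single R (fun _ : Fin (n + 1) => X) 0)
      (g := LinearMap.funLeft R X Fin.succ) (fun _ _ h => by simpa using congrFun h 0) (fun y => ?_)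
      (LinearMap.funLeft_surjective_of_injective _ _ _ (Fin.succ_injective n)) h ih
    constructor
    · intro hy
      refine ⟨y 0, funext fun i => ?_⟩
      cases i using Fin.cases with
      | zero => simp
      | succ i => simpa using (congrFun hy i).symm
    · rintro ⟨x, rfl⟩
      ext i
      simp [LinearMap.funLeft]

theorem DepthAt.linearMap_free {t : ℕ} (h : DepthAt p t X) (n : ℕ) :
    DepthAt p t ((Fin n → R) →ₗ[R] X) :=
  (h.pi n).congr (Module.piEquiv (Fin n) R X)

theorem lcomp_subtype_ker_surjective {π : B →ₗ[R] A} (hπ : Function.Surjective π)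
    (h : ExtZero R 1 A X) :
    Function.Surjective (LinearMap.lcomp R X (LinearMap.ker π).subtype) :=
  ExtZero.exists_extension (LinearMap.ker π).injective_subtype (LinearMap.exact_subtype_ker_map π)
    hπ h

/-- The restriction map `Hom(F, N) → Hom(ker π, N)` identifies the quotient by `Hom(M, N)`
when `Ext^1(M, N) = 0`. -/
theorem exists_quotient_equiv {n : ℕ} {π : (Fin n → R) →ₗ[R] A} (hπ : Function.Surjective π)
    (h : ExtZero R 1 A X) :
    Nonempty ((((Fin n → R) →ₗ[R] X) ⧸ LinearMap.range (LinearMap.lcomp R X π)) ≃ₗ[R]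
      (LinearMap.ker π →ₗ[R] X)) := by
  have hex := LinearMap.exact_lcomp_of_exact_of_surjective X (LinearMap.exact_subtype_ker_map π) hπ
  exact ⟨(Submodule.quotEquivOfEq _ _ (LinearMap.exact_iff.1 hex).symm).trans
    (LinearMap.quotKerEquivOfSurjective _ (lcomp_subtype_ker_surjective hπ h))⟩

theorem exists_quotient_injective {n : ℕ} {π : (Fin n → R) →ₗ[R] A} (hπ : Function.Surjective π) :
    ∃ f : (((Fin n → R) →ₗ[R] X) ⧸ LinearMap.range (LinearMap.lcomp R X π)) →ₗ[R]
      (LinearMap.ker π →ₗ[R] X), Function.Injective f ∧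
      ∀ φ, f (Submodule.Quotient.mk φ) = φ ∘ₗ (LinearMap.ker π).subtype := by
  have hex := LinearMap.exact_lcomp_of_exact_of_surjective X (LinearMap.exact_subtype_ker_map π) hπ
  refine ⟨Submodule.liftQ _ (LinearMap.lcomp R X (LinearMap.ker π).subtype)
    (LinearMap.exact_iff.1 hex).symm.le, ?_, fun φ => rfl⟩
  rw [← LinearMap.ker_eq_bot]
  exact Submodule.ker_liftQ_eq_bot' _ _ (LinearMap.exact_iff.1 hex).symm

theorem ExtZero.ker {n : ℕ} {π : (Fin n → R) →ₗ[R] A} (hπ : Function.Surjective π) {i : ℕ}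
    (h : ExtZero R (i + 2) A X) : ExtZero R (i + 1) (LinearMap.ker π) X :=
  ExtZero.contra_left (LinearMap.ker π).injective_subtype (LinearMap.exact_subtype_ker_map π) hπ
    (ExtZero.of_projective i) h

theorem DepthAt.hom_of_quotient {e s n : ℕ} (hX : DepthAt p e X) {π : (Fin n → R) →ₗ[R] A}
    (hπ : Function.Surjective π)
    (h : DepthAt p (min e s)
      (((Fin n → R) →ₗ[R] X) ⧸ LinearMap.range (LinearMap.lcomp R X π))) :
    DepthAt p (min e (s + 1)) (A →ₗ[R] X) := by
  cases e with
  | zero => exact DepthAt.zero.mono (by omega)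
  | succ e =>
    rw [Nat.add_min_add_right]
    exact DepthAt.left (LinearMap.lcomp_injective_of_surjective π hπ)
      (LinearMap.exact_map_mkQ_range _) (Submodule.mkQ_surjective _)
      ((hX.linearMap_free n).mono (by omega)) (h.mono (by omega))

variable [IsNoetherianRing R]

theorem DepthAt.quotient {e : ℕ} (hX : DepthAt p e X) {t : ℕ} [Module.Finite R A]
    (h : ∀ i, i < t → ExtZero R (i + 1) A X) {n : ℕ} {π : (Fin n → R) →ₗ[R] A}
    (hπ : Function.Surjective π) :
    DepthAt p (min e (t + 1))
      (((Fin n → R) →ₗ[R] X) ⧸ LinearMap.range (LinearMap.lcomp R X π)) := by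
  induction t generalizing A n with
  | zero =>
    cases e with
    | zero => exact DepthAt.zero.mono (by omega)
    | succ e =>
      obtain ⟨f, hf, -⟩ := exists_quotient_injective (X := X) hπ
      obtain ⟨b, ρ, hρ⟩ := Module.Finite.exists_fin' R (LinearMap.ker π)
      refine (DepthAt.one_of_injective (f := LinearMap.lcomp R X ρ ∘ₗ f)
        ((LinearMap.lcomp_injective_of_surjective ρ hρ).comp hf)
        ((hX.linearMap_free b).mono (by omega))).mono (by omega)
  | succ t ih =>
    obtain ⟨E⟩ := exists_quotient_equiv hπ (h 0 (by omega))
    obtain ⟨b, ρ, hρ⟩ := Module.Finite.exists_fin' R (LinearMap.ker π)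
    have := ih (A := LinearMap.ker π) (fun i hi => ExtZero.ker hπ (h (i + 1) (by omega))) hρ
    exact (DepthAt.hom_of_quotient hX hρ this).congr E.symm

theorem DepthAt.hom {e : ℕ} (hX : DepthAt p e X) {t : ℕ} [Module.Finite R A]
    (h : ∀ i, i < t → ExtZero R (i + 1) A X) : DepthAt p (min e (t + 2)) (A →ₗ[R] X) := by
  obtain ⟨b, ρ, hρ⟩ := Module.Finite.exists_fin' R A
  exact hX.hom_of_quotient hρ (hX.quotient h hρ)

end DepthAt

section Evaluation

variable {R : Type} [CommRing R] {A B N W : Type}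
  [AddCommGroup A] [Module R A] [AddCommGroup B] [Module R B] [AddCommGroup N] [Module R N]
  [AddCommGroup W] [Module R W]

variable (R A N W) in
/-- The evaluation map `A ⊗ Hom(N, W) → Hom(Hom(A, N), W)`. -/
def tensorHomEval : A ⊗[R] (N →ₗ[R] W) →ₗ[R] ((A →ₗ[R] N) →ₗ[R] W) :=
  TensorProduct.lift (LinearMap.mk₂ R (fun a f => f ∘ₗ LinearMap.applyₗ a)
    (fun _ _ _ => by ext; simp) (fun _ _ _ => by ext; simp) (fun _ _ _ => by ext; simp)
    (fun _ _ _ => by ext; simp))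

@[simp]
theorem tensorHomEval_tmul (a : A) (f : N →ₗ[R] W) (g : A →ₗ[R] N) :
    tensorHomEval R A N W (a ⊗ₜ f) g = f (g a) := rfl

theorem tensorHomEval_rTensor (u : A →ₗ[R] B) (t : A ⊗[R] (N →ₗ[R] W)) :
    tensorHomEval R B N W (u.rTensor _ t) = tensorHomEval R A N W t ∘ₗ LinearMap.lcomp R N u := by
  induction t with
  | zero => simp
  | add s t hs ht => rw [map_add, map_add, map_add, hs, ht, LinearMap.add_comp]
  | tmul a f => ext g; simp

theorem tensorHomEval_bijective_of_free (n : ℕ) :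
    Function.Bijective (tensorHomEval R (Fin n → R) N W) := by
  classical
  let inv : (((Fin n → R) →ₗ[R] N) →ₗ[R] W) → (Fin n → R) ⊗[R] (N →ₗ[R] W) := fun φ =>
    ∑ i, (Pi.single i 1) ⊗ₜ (φ ∘ₗ LinearMap.smulRightₗ (LinearMap.proj i))
  have inv_add (φ ψ) : inv (φ + ψ) = inv φ + inv ψ := by
    simp only [inv, LinearMap.add_comp, TensorProduct.tmul_add, Finset.sum_add_distrib]
  refine Function.bijective_iff_has_inverse.2 ⟨inv, fun t => ?_, fun φ => ?_⟩
  · induction t with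
    | zero => simp [inv]
    | add s t hs ht => rw [map_add, inv_add, hs, ht]
    | tmul v f =>
      have (i : Fin n) : tensorHomEval R (Fin n → R) N W (v ⊗ₜ f) ∘ₗ
          LinearMap.smulRightₗ (LinearMap.proj i) = v i • f := by
        ext x; simp
      simp only [inv, this, TensorProduct.tmul_smul, TensorProduct.smul_tmul', ← TensorProduct.sum_tmul]
      congr 1
      ext j
      simp [Finset.sum_apply, Pi.single_apply]
  · ext g
    simp only [inv, map_sum, LinearMap.sum_apply, tensorHomEval_tmul, LinearMap.comp_apply]
    rw [← map_sum]
    congr 1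
    ext j
    simp [Pi.single_apply]

theorem tensorHomEval_surjective_of_extZero {n : ℕ} {π : (Fin n → R) →ₗ[R] A}
    (hπ : Function.Surjective π)
    (h : ExtZero R 1 (((Fin n → R) →ₗ[R] N) ⧸ LinearMap.range (LinearMap.lcomp R N π)) W) :
    Function.Surjective (tensorHomEval R A N W) := by
  intro φ
  obtain ⟨ψ, rfl⟩ := ExtZero.exists_extension (LinearMap.lcomp_injective_of_surjective π hπ)
    (LinearMap.exact_map_mkQ_range _) (Submodule.mkQ_surjective _) h φ
  obtain ⟨s, rfl⟩ := (tensorHomEval_bijective_of_free n).2 ψ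
  exact ⟨π.rTensor _ s, tensorHomEval_rTensor π s⟩

theorem tensorHomEval_injective_of_extension {n : ℕ} {π : (Fin n → R) →ₗ[R] A}
    (hπ : Function.Surjective π)
    (hK : Function.Surjective (tensorHomEval R (LinearMap.ker π) N W))
    (hext : ∀ f : (((Fin n → R) →ₗ[R] N) ⧸ LinearMap.range (LinearMap.lcomp R N π)) →ₗ[R]
      (LinearMap.ker π →ₗ[R] N),
      (∀ φ, f (Submodule.Quotient.mk φ) = φ ∘ₗ (LinearMap.ker π).subtype) →
      ExtZero R 1 ((LinearMap.ker π →ₗ[R] N) ⧸ LinearMap.range f) W) :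
    Function.Injective (tensorHomEval R A N W) := by
  rw [injective_iff_map_eq_zero]
  intro t ht
  obtain ⟨s, rfl⟩ := LinearMap.rTensor_surjective (N →ₗ[R] W) hπ t
  rw [tensorHomEval_rTensor] at ht
  obtain ⟨f, hf, hf'⟩ := exists_quotient_injective (X := N) hπ
  obtain ⟨χ, hχ⟩ := ExtZero.exists_extension hf (LinearMap.exact_map_mkQ_range f)
    (Submodule.mkQ_surjective _) (hext f hf')
    (Submodule.liftQ _ (tensorHomEval R (Fin n → R) N W s) (LinearMap.range_le_ker_iff.2 ht))
  obtain ⟨u, rfl⟩ := hK χ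
  have hs : (LinearMap.ker π).subtype.rTensor (N →ₗ[R] W) u = s := by
    apply (tensorHomEval_bijective_of_free n).1
    rw [tensorHomEval_rTensor]
    ext φ
    have := LinearMap.congr_fun hχ (Submodule.Quotient.mk φ)
    rw [LinearMap.comp_apply, hf'] at this
    exact this
  rw [← hs, ← LinearMap.rTensor_comp_apply, LinearMap.comp_ker_subtype, LinearMap.rTensor_zero,
    LinearMap.zero_apply]

variable [IsNoetherianRing R] [IsLocalRing R]

theorem tensorHomEval_surjective {d t : ℕ} [Module.Finite R A] [Module.Finite R N]
    [Module.Finite R W]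
    (hW : ∀ i, d < i → ∀ (Y : Type) [AddCommGroup Y] [Module R Y] [Module.Finite R Y],
      ExtZero R i Y W) (hN : DepthAt (maximalIdeal R) d N) (ht : d ≤ t + 1)
    (hA : ∀ i, i < t → ExtZero R (i + 1) A N) :
    Function.Surjective (tensorHomEval R A N W) := by
  obtain ⟨n, π, hπ⟩ := Module.Finite.exists_fin' R A
  refine tensorHomEval_surjective_of_extZero hπ (ExtZero.of_depthGE hW (t := d) ?_ (by omega))
  exact DepthGE.of_localizedModule ((hN.quotient hA hπ).mono (by omega))

theorem tensorHomEval_bijective {d : ℕ} [Module.Finite R A] [Module.Finite R N]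
    [Module.Finite R W]
    (hW : ∀ i, d < i → ∀ (Y : Type) [AddCommGroup Y] [Module R Y] [Module.Finite R Y],
      ExtZero R i Y W) (hN : DepthAt (maximalIdeal R) d N)
    (hA : ∀ i, i < d → ExtZero R (i + 1) A N) :
    Function.Bijective (tensorHomEval R A N W) := by
  refine ⟨?_, tensorHomEval_surjective hW hN (by omega) hA⟩
  obtain ⟨n, π, hπ⟩ := Module.Finite.exists_fin' R A
  refine tensorHomEval_injective_of_extension hπ
    (tensorHomEval_surjective (t := d - 1) hW hN (by omega)
      fun i hi => ExtZero.ker hπ (hA (i + 1) (by omega))) ?_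
  rcases Nat.eq_zero_or_pos d with rfl | hd
  · exact fun f _ => hW 1 one_pos _
  · intro f hf
    have hsurj : Function.Surjective f := fun ψ => by
      obtain ⟨φ, rfl⟩ := lcomp_subtype_ker_surjective hπ (hA 0 hd) ψ
      exact ⟨_, hf φ⟩
    have := Submodule.Quotient.subsingleton_iff.2 (LinearMap.range_eq_top.2 hsurj)
    exact ExtZero.of_subsingleton_left 1

end Evaluation

section MaximalCohenMacaulay

variable {R : Type} [CommRing R] {X : Type} [AddCommGroup X] [Module R X]

theorem IsMCM.depthAt (hX : IsMCM R X) (p : Ideal R) [hp : p.IsPrime] {e : ℕ}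
    (he : ringKrullDim (Localization.AtPrime p) = e) : DepthAt p e X := by
  rcases subsingleton_or_nontrivial (LocalizedModule p.primeCompl X) with h | h
  · exact DepthGE.of_subsingleton e
  · have := hX ⟨p, hp⟩ h
    exact (le_moduleDepth_iff e).1 (WithBot.coe_le_coe.1 (he.symm.trans this.symm).le)

theorem ringKrullDim_localization_eq_of_le (p : Ideal R) [hp : p.IsPrime] {d : ℕ}
    (hd : ringKrullDim R = d) : ∃ e : ℕ, ringKrullDim (Localization.AtPrime p) = e := by
  have h := Ideal.height_le_ringKrullDim_of_ne_top hp.ne_top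
  rw [hd] at h
  have hlt : p.height ≤ (d : ℕ∞) := WithBot.coe_le_coe.1 h
  obtain ⟨e, he⟩ := ENat.ne_top_iff_exists.1 (ne_top_of_le_ne_top (ENat.natCast_ne_top d) hlt)
  exact ⟨e, by rw [IsLocalization.AtPrime.ringKrullDim_eq_height p, ← he]; rfl⟩

theorem moduleDepth_eq_ringKrullDim [IsLocalRing R] [IsNoetherianRing R] [Module.Finite R X]
    [Nontrivial X] {e : ℕ} (he : ringKrullDim R = e) (h : DepthGE R e X) :
    (moduleDepth R X : WithBot ℕ∞) = ringKrullDim R := by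
  rw [he]
  refine congrArg _ (le_antisymm ?_ ((le_moduleDepth_iff e).2 h))
  refine ENat.forall_natCast_le_iff_le.1 fun t ht => ?_
  have := ((le_moduleDepth_iff t).1 ht).le_ringKrullDim
  rw [he] at this
  exact WithBot.coe_le_coe.1 this

end MaximalCohenMacaulay

/-- If `N` is MCM over a `d`-dimensional CM local ring with canonical module `ω` and
`Ext^i(M, N) = 0` for `1 ≤ i ≤ d`, then `M ⊗ Hom(N, ω)` is MCM. -/
theorem tensor_dual_mcm_of_ext_vanishing (R : Type) [CommRing R] [IsNoetherianRing R]
    [IsLocalRing R] (d : ℕ) (hd : ringKrullDim R = d) (hCM : IsCMLocal R)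
    (ω : Type) [AddCommGroup ω] [Module R ω] (hω : IsCanonicalModule R ω)
    (M N : Type) [AddCommGroup M] [Module R M] [Module.Finite R M]
    [AddCommGroup N] [Module R N] [Module.Finite R N]
    (hN : IsMCM R N)
    (hvan : ∀ i : ℕ, 1 ≤ i → i ≤ d → Subsingleton (extGroup R i M N)) :
    IsMCM R (TensorProduct R M (N →ₗ[R] ω)) := by
  obtain ⟨hfin, hωMCM, ⟨n, hn⟩, -⟩ := hω
  have hdepth : moduleDepth R R = d := WithBot.coe_injective (Eq.trans hCM hd)
  have hR : DepthGE R d R := (le_moduleDepth_iff d).1 hdepth.ge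
  have hR' : ¬ ExtZero R d (R ⧸ maximalIdeal R) R := fun h => by
    have h' : ((d + 1 : ℕ) : ℕ∞) ≤ moduleDepth R R := (le_moduleDepth_iff (d + 1)).2 fun i hi =>
      (Nat.lt_succ_iff_lt_or_eq.1 hi).elim (hR i) fun hi => hi ▸ h
    rw [hdepth, Nat.cast_le] at h'
    omega
  have hW (i : ℕ) (hi : d < i) (Y : Type) [AddCommGroup Y] [Module R Y] [Module.Finite R Y] :
      ExtZero R i Y ω := ExtZero.of_depth_lt hn hR hR' hi
  have hdm : ringKrullDim (Localization.AtPrime (maximalIdeal R)) = d := by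
    rw [IsLocalization.AtPrime.ringKrullDim_eq_height (maximalIdeal R),
      IsLocalRing.maximalIdeal_height_eq_ringKrullDim, hd]
  have hNm : DepthAt (maximalIdeal R) d N := hN.depthAt _ hdm
  have hA (i : ℕ) (hi : i < d) : ExtZero R (i + 1) M N :=
    (subsingleton_extGroup_iff _).1 (hvan (i + 1) (by omega) (by omega))
  have hL : DepthGE R d (M →ₗ[R] N) :=
    DepthGE.of_localizedModule ((hNm.hom hA).mono (by omega))
  let E := LinearEquiv.ofBijective _ (tensorHomEval_bijective hW hNm hA)
  intro p hp
  obtain ⟨e, he⟩ := ringKrullDim_localization_eq_of_le p.asIdeal hd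
  have hωp : DepthAt p.asIdeal e ω := hωMCM.depthAt _ he
  refine moduleDepth_eq_ringKrullDim he (DepthAt.congr E.symm ?_)
  exact (hωp.hom (t := e) fun i _ => ExtZero.of_depthGE hW hL (by omega)).mono (by omega)
end

section
/- Let R be a d-dimensional Cohen–Macaulay local ring with canonical module ω, and let M, N be finitely generated R-modules. Assume N is maximal Cohen–Macaulay and dim_R Tor_i^R(M, N) < i for all 1 ≤ i ≤ d. Then M ⊗_R N is maximal Cohen–Macaulay if and only if Ext^i_R(M, Hom_R(N, ω)) = 0 for all 1 ≤ i ≤ d. -/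
open CategoryTheory TensorProduct IsLocalRing

/-- Vanishing of `Ext^i(M, N)`. -/
def ExtVanishes (R : Type) [CommRing R] (M N : Type) [AddCommGroup M] [Module R M]
    [AddCommGroup N] [Module R N] (i : ℕ) : Prop :=
  Subsingleton (Abelian.Ext (ModuleCat.of R M) (ModuleCat.of R N) i)

theorem subsingleton_ext_iff_of_projectiveResolution {R : Type} [CommRing R]
    {X : ModuleCat.{0} R} (P : ProjectiveResolution X) (Y : ModuleCat.{0} R) (n : ℕ) :
    Subsingleton (Abelian.Ext X Y (n + 1)) ↔
      ∀ f : P.complex.X (n + 1) ⟶ Y, P.complex.d (n + 2) (n + 1) ≫ f = 0 →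
        ∃ g : P.complex.X n ⟶ Y, P.complex.d (n + 1) n ≫ g = f := by
  constructor
  · intro h f hf
    exact (P.extMk_eq_zero_iff f (n + 2) rfl hf n rfl).1 (Subsingleton.elim _ _)
  · intro h
    refine subsingleton_of_forall_eq 0 fun α => ?_
    obtain ⟨f, hf, rfl⟩ := P.extMk_surjective α (n + 2) rfl
    exact (P.extMk_eq_zero_iff f (n + 2) rfl hf n rfl).2 (h f hf)

theorem subsingleton_extGroup_succ_iff {R : Type} [CommRing R] {M N : Type}
    [AddCommGroup M] [Module R M] [AddCommGroup N] [Module R N] (n : ℕ) :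
    Subsingleton (extGroup R (n + 1) M N) ↔ ExtVanishes R M N (n + 1) := by
  let P := ProjectiveResolution.of (ModuleCat.of R M)
  rw [ExtVanishes, subsingleton_ext_iff_of_projectiveResolution P]
  have e := (P.isoExt (n + 1) (ModuleCat.of R N) (R := R))
  rw [e.toLinearEquiv.toEquiv.subsingleton_congr, ← ModuleCat.isZero_iff_subsingleton,
    ← HomologicalComplex.exactAt_iff_isZero_homology,
    HomologicalComplex.exactAt_iff' _ n (n + 1) (n + 2) (by simp) (by simp),
    ShortComplex.moduleCat_exact_iff]
  rfl

theorem subsingleton_extGroup_iff_s9 {R : Type} [CommRing R] {M N : Type}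
    [AddCommGroup M] [Module R M] [AddCommGroup N] [Module R N] (n : ℕ) :
    Subsingleton (extGroup R n M N) ↔ ExtVanishes R M N n := by
  cases n with
  | succ n => exact subsingleton_extGroup_succ_iff n
  | zero =>
    let P := ProjectiveResolution.of (ModuleCat.of R M)
    have e := (P.isoExt 0 (ModuleCat.of R N) (R := R))
    rw [ExtVanishes, Abelian.Ext.homEquiv₀.subsingleton_congr,
      e.toLinearEquiv.toEquiv.subsingleton_congr, ← ModuleCat.isZero_iff_subsingleton,
      ← HomologicalComplex.exactAt_iff_isZero_homology,
      HomologicalComplex.exactAt_iff' _ 0 0 1 (by simp) (by simp),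
      ShortComplex.moduleCat_exact_iff]
    have hd : (P.complex.linearYonedaObj R (ModuleCat.of R N)).d 0 0 = 0 :=
      HomologicalComplex.shape _ _ _ (by simp)
    constructor
    · intro h
      refine subsingleton_of_forall_eq 0 fun g => ?_
      let g' : ((ChainComplex.single₀ (ModuleCat R)).obj (ModuleCat.of R M)).X 0 ⟶
        ModuleCat.of R N := g
      change g' = 0
      obtain ⟨y, hy⟩ := h (P.π.f 0 ≫ g') (by
        change P.complex.d 1 0 ≫ P.π.f 0 ≫ g' = 0
        rw [← Category.assoc, P.complex_d_comp_π_f_zero, Limits.zero_comp])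
      have hy' : P.π.f 0 ≫ g' = 0 := by
        rw [← hy]
        dsimp only [HomologicalComplex.sc', HomologicalComplex.shortComplexFunctor']
        rw [hd]
        rfl
      rw [← cancel_epi (P.π.f 0), hy', Limits.comp_zero]
    · intro h (f : P.complex.X 0 ⟶ ModuleCat.of R N) hf
      replace hf : P.complex.d 1 0 ≫ f = 0 := hf
      refine ⟨0, ?_⟩
      rw [map_zero]
      have hg := P.exact₀.g_desc f hf
      have h0 : P.exact₀.desc f hf = 0 :=
        Subsingleton.elim (α := (ModuleCat.of R M ⟶ ModuleCat.of R N)) _ _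
      rw [h0, Limits.comp_zero] at hg
      exact hg

namespace ExtVanishes

section LongExactSequence

variable {R : Type} [CommRing R] {A B C X : Type} [AddCommGroup A] [Module R A]
  [AddCommGroup B] [Module R B] [AddCommGroup C] [Module R C] [AddCommGroup X] [Module R X]

theorem exists_shortExact {f : A →ₗ[R] B} {g : B →ₗ[R] C} (hf : Function.Injective f)
    (hg : Function.Surjective g) (hfg : Function.Exact f g) :
    ∃ S : ShortComplex (ModuleCat.{0} R), S.ShortExact ∧ S.X₁ = ModuleCat.of R A ∧
      S.X₂ = ModuleCat.of R B ∧ S.X₃ = ModuleCat.of R C := by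
  refine ⟨ShortComplex.mk (ModuleCat.ofHom f) (ModuleCat.ofHom g) ?_, ?_, rfl, rfl, rfl⟩
  · ext x
    exact hfg.apply_apply_eq_zero x
  · refine ShortComplex.ShortExact.mk' ?_ ((ModuleCat.mono_iff_injective _).2 hf)
      ((ModuleCat.epi_iff_surjective _).2 hg)
    exact (ShortComplex.ShortExact.moduleCat_exact_iff_function_exact _).2 hfg

variable {f : A →ₗ[R] B} {g : B →ₗ[R] C} {i : ℕ}

theorem fst_middle (hf : Function.Injective f) (hg : Function.Surjective g)
    (hfg : Function.Exact f g) (hA : ExtVanishes R A X i) (hC : ExtVanishes R C X i) :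
    ExtVanishes R B X i := by
  obtain ⟨S, hS, h₁, h₂, h₃⟩ := exists_shortExact hf hg hfg
  unfold ExtVanishes at *
  rw [← h₁] at hA; rw [← h₂]; rw [← h₃] at hC
  refine subsingleton_of_forall_eq 0 fun x => ?_
  obtain ⟨y, rfl⟩ := Abelian.Ext.contravariant_sequence_exact₂ hS _ x (Subsingleton.elim _ _)
  rw [Subsingleton.elim y 0, Abelian.Ext.comp_zero]

theorem fst_right (hf : Function.Injective f) (hg : Function.Surjective g)
    (hfg : Function.Exact f g) (hA : ExtVanishes R A X i) (hB : ExtVanishes R B X (i + 1)) :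
    ExtVanishes R C X (i + 1) := by
  obtain ⟨S, hS, h₁, h₂, h₃⟩ := exists_shortExact hf hg hfg
  unfold ExtVanishes at *
  rw [← h₁] at hA; rw [← h₂] at hB; rw [← h₃]
  refine subsingleton_of_forall_eq 0 fun x => ?_
  obtain ⟨y, rfl⟩ := Abelian.Ext.contravariant_sequence_exact₃ hS _ x (Subsingleton.elim _ _)
    (add_comm 1 i)
  rw [Subsingleton.elim y 0, Abelian.Ext.comp_zero]

theorem fst_left (hf : Function.Injective f) (hg : Function.Surjective g)
    (hfg : Function.Exact f g) (hB : ExtVanishes R B X i) (hC : ExtVanishes R C X (i + 1)) :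
    ExtVanishes R A X i := by
  obtain ⟨S, hS, h₁, h₂, h₃⟩ := exists_shortExact hf hg hfg
  unfold ExtVanishes at *
  rw [← h₂] at hB; rw [← h₁]; rw [← h₃] at hC
  refine subsingleton_of_forall_eq 0 fun x => ?_
  obtain ⟨y, rfl⟩ := Abelian.Ext.contravariant_sequence_exact₁ hS _ x (add_comm 1 i)
    (Subsingleton.elim _ _)
  rw [Subsingleton.elim y 0, Abelian.Ext.comp_zero]

theorem snd_right (hf : Function.Injective f) (hg : Function.Surjective g)
    (hfg : Function.Exact f g) (hB : ExtVanishes R X B i) (hA : ExtVanishes R X A (i + 1)) :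
    ExtVanishes R X C i := by
  obtain ⟨S, hS, h₁, h₂, h₃⟩ := exists_shortExact hf hg hfg
  unfold ExtVanishes at *
  rw [← h₂] at hB; rw [← h₁] at hA; rw [← h₃]
  refine subsingleton_of_forall_eq 0 fun x => ?_
  obtain ⟨y, rfl⟩ := Abelian.Ext.covariant_sequence_exact₃ _ hS x rfl (Subsingleton.elim _ _)
  rw [Subsingleton.elim y 0, Abelian.Ext.zero_comp]

theorem snd_left (hf : Function.Injective f) (hg : Function.Surjective g)
    (hfg : Function.Exact f g) (hB : ExtVanishes R X B (i + 1)) (hC : ExtVanishes R X C i) :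
    ExtVanishes R X A (i + 1) := by
  obtain ⟨S, hS, h₁, h₂, h₃⟩ := exists_shortExact hf hg hfg
  unfold ExtVanishes at *
  rw [← h₂] at hB; rw [← h₁]; rw [← h₃] at hC
  refine subsingleton_of_forall_eq 0 fun x => ?_
  obtain ⟨y, rfl⟩ := Abelian.Ext.covariant_sequence_exact₁ _ hS x (Subsingleton.elim _ _) rfl
  rw [Subsingleton.elim y 0, Abelian.Ext.zero_comp]

theorem of_subsingleton_fst [Subsingleton A] : ExtVanishes R A X i := by
  refine subsingleton_of_forall_eq 0 fun x => ?_
  rw [← Abelian.Ext.mk₀_id_comp x,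
    show 𝟙 (ModuleCat.of R A) = 0 by ext; exact Subsingleton.elim _ _,
    Abelian.Ext.mk₀_zero, Abelian.Ext.zero_comp]

theorem congr_fst (e : A ≃ₗ[R] B) (h : ExtVanishes R A X i) : ExtVanishes R B X i :=
  fst_middle (g := (0 : B →ₗ[R] PUnit)) e.injective (Function.surjective_to_subsingleton _)
    (fun y => ⟨fun _ => e.surjective y, fun _ => rfl⟩) h of_subsingleton_fst

theorem of_subsingleton_snd [Subsingleton A] : ExtVanishes R X A i := by
  refine subsingleton_of_forall_eq 0 fun x => ?_
  rw [← Abelian.Ext.comp_mk₀_id x,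
    show 𝟙 (ModuleCat.of R A) = 0 by ext; exact Subsingleton.elim _ _,
    Abelian.Ext.mk₀_zero, Abelian.Ext.comp_zero]

theorem prod_fst (hA : ExtVanishes R A X i) (hB : ExtVanishes R B X i) :
    ExtVanishes R (A × B) X i :=
  fst_middle (f := LinearMap.inl R A B) (g := LinearMap.snd R A B) LinearMap.inl_injective
    LinearMap.snd_surjective Function.Exact.inl_snd hA hB

theorem zero_iff : ExtVanishes R A X 0 ↔ Subsingleton (A →ₗ[R] X) :=
  (Abelian.Ext.addEquiv₀.trans ModuleCat.homAddEquiv).toEquiv.subsingleton_congr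

theorem of_projective [Module.Projective R A] : ExtVanishes R A X (i + 1) :=
  Abelian.Ext.subsingleton_of_projective _ _ _

/-- `Ext^1(C, X)` vanishes iff every map `A → X` extends to `B`, provided `Ext^1(B, X) = 0`. -/
theorem one_iff (hf : Function.Injective f) (hg : Function.Surjective g)
    (hfg : Function.Exact f g) (hB : ExtVanishes R B X 1) :
    ExtVanishes R C X 1 ↔ ∀ φ : A →ₗ[R] X, ∃ ψ : B →ₗ[R] X, ψ ∘ₗ f = φ := by
  let S : ShortComplex (ModuleCat.{0} R) :=
    ShortComplex.mk (ModuleCat.ofHom f) (ModuleCat.ofHom g) (by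
      ext x
      exact hfg.apply_apply_eq_zero x)
  have hS : S.ShortExact := ShortComplex.ShortExact.mk'
    ((ShortComplex.ShortExact.moduleCat_exact_iff_function_exact _).2 hfg)
    ((ModuleCat.mono_iff_injective _).2 hf) ((ModuleCat.epi_iff_surjective _).2 hg)
  constructor
  · intro h φ
    have h' : Subsingleton (Abelian.Ext S.X₃ (ModuleCat.of R X) 1) := h
    obtain ⟨y, hy⟩ := Abelian.Ext.contravariant_sequence_exact₁ hS _
      (Abelian.Ext.mk₀ (ModuleCat.ofHom φ)) (add_zero 1) (Subsingleton.elim _ _)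
    obtain ⟨ψ, rfl⟩ := (Abelian.Ext.mk₀_bijective _ _).2 y
    rw [Abelian.Ext.mk₀_comp_mk₀] at hy
    have := (Abelian.Ext.mk₀_bijective _ _).1 hy
    exact ⟨ψ.hom, congrArg ModuleCat.Hom.hom this⟩
  · intro h
    refine subsingleton_of_forall_eq 0 fun x => ?_
    have hB' : Subsingleton (Abelian.Ext S.X₂ (ModuleCat.of R X) 1) := hB
    obtain ⟨y, rfl⟩ := Abelian.Ext.contravariant_sequence_exact₃ hS _ x (Subsingleton.elim _ _)
      (add_zero 1)
    obtain ⟨φ, rfl⟩ := (Abelian.Ext.mk₀_bijective _ _).2 y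
    obtain ⟨ψ, hψ⟩ := h φ.hom
    have : φ = S.f ≫ ModuleCat.ofHom ψ := by
      ext x
      exact (LinearMap.congr_fun hψ x).symm
    rw [this, ← Abelian.Ext.mk₀_comp_mk₀,
      ← Abelian.Ext.comp_assoc _ _ _ (add_zero 1) (add_zero 0) rfl, hS.extClass_comp,
      Abelian.Ext.zero_comp]

end LongExactSequence

end ExtVanishes

theorem isSMulRegular_quotient_of_notMem {R : Type} [CommRing R] (p : PrimeSpectrum R)
    {x : R} (hx : x ∉ p.asIdeal) : IsSMulRegular (R ⧸ p.asIdeal) x := by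
  rw [isSMulRegular_iff_right_eq_zero_of_smul]
  intro y hy
  obtain ⟨y, rfl⟩ := Ideal.Quotient.mk_surjective y
  rw [Algebra.smul_def, Ideal.Quotient.algebraMap_eq, ← map_mul,
    Ideal.Quotient.eq_zero_iff_mem] at hy
  exact Ideal.Quotient.eq_zero_iff_mem.2 ((p.isPrime.mem_or_mem hy).resolve_left hx)

namespace ExtVanishes

section QuotSMulTop

variable {R : Type} [CommRing R] {A X : Type} [AddCommGroup A] [Module R A]
  [AddCommGroup X] [Module R X] {x : R} {i : ℕ}

theorem quotSMulTop_fst (hx : IsSMulRegular A x) (h₀ : ExtVanishes R A X i)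
    (h₁ : ExtVanishes R A X (i + 1)) : ExtVanishes R (QuotSMulTop x A) X (i + 1) :=
  fst_right (f := LinearMap.lsmul R A x) hx (Submodule.mkQ_surjective _)
    ((ShortComplex.ShortExact.moduleCat_exact_iff_function_exact _).1
      (IsSMulRegular.smulShortComplex_shortExact (M := ModuleCat.of R A) hx).exact) h₀ h₁

theorem quotSMulTop_snd (hx : IsSMulRegular A x) (h₀ : ExtVanishes R X A i)
    (h₁ : ExtVanishes R X A (i + 1)) : ExtVanishes R X (QuotSMulTop x A) i :=
  snd_right (f := LinearMap.lsmul R A x) hx (Submodule.mkQ_surjective _)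
    ((ShortComplex.ShortExact.moduleCat_exact_iff_function_exact _).1
      (IsSMulRegular.smulShortComplex_shortExact (M := ModuleCat.of R A) hx).exact) h₀ h₁

theorem of_quotSMulTop_snd (hx : IsSMulRegular A x) (hxX : x ∈ Module.annihilator R X)
    (h : ExtVanishes R X (QuotSMulTop x A) i) : ExtVanishes R X A (i + 1) := by
  have hS := IsSMulRegular.smulShortComplex_shortExact (M := ModuleCat.of R A) hx
  refine subsingleton_of_forall_eq 0 fun y => ?_
  have h' : Subsingleton (Abelian.Ext (ModuleCat.of R X)
    ((ModuleCat.of R A).smulShortComplex x).X₃ i) := h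
  have hy := DFunLike.congr_fun (congrArg AddCommGrpCat.Hom.hom
    (Abelian.Ext.postcomp_smul_id_eq_zero_of_mem_annihilator (M := ModuleCat.of R A)
      (N := ModuleCat.of R X) hxX (i + 1))) y
  obtain ⟨z, hz⟩ := Abelian.Ext.covariant_sequence_exact₁ _ hS y hy rfl
  rw [← hz, Subsingleton.elim z 0, Abelian.Ext.zero_comp]
  rfl

theorem of_quotSMulTop_fst [IsNoetherianRing R] [IsLocalRing R] [Module.Finite R A]
    [Module.Finite R X] (hx : IsSMulRegular A x) (hxm : x ∈ maximalIdeal R)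
    (h : ExtVanishes R (QuotSMulTop x A) X (i + 1)) : ExtVanishes R A X i := by
  have hS := IsSMulRegular.smulShortComplex_shortExact (M := ModuleCat.of R A) hx
  have h' : Subsingleton (Abelian.Ext ((ModuleCat.of R A).smulShortComplex x).X₃
    (ModuleCat.of R X) (i + 1)) := h
  have : Module.Finite R (Abelian.Ext (ModuleCat.of R A) (ModuleCat.of R X) i) :=
    ModuleCat.finite_ext R _ _ i
  have key : (⊤ : Submodule R (Abelian.Ext (ModuleCat.of R A) (ModuleCat.of R X) i)) = ⊥ := by
    refine Submodule.eq_bot_of_le_smul_of_le_jacobson_bot (maximalIdeal R) _ Module.Finite.fg_top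
      (fun y _ => ?_) (IsLocalRing.maximalIdeal_le_jacobson _)
    obtain ⟨z, rfl⟩ := Abelian.Ext.contravariant_sequence_exact₁ hS _ y (add_comm 1 i)
      (Subsingleton.elim _ _)
    have hz (w : Abelian.Ext (ModuleCat.of R A) (ModuleCat.of R X) i) :
        (Abelian.Ext.mk₀ (x • 𝟙 (ModuleCat.of R A))).comp w (zero_add i) = x • w := by
      rw [Abelian.Ext.mk₀_smul, Abelian.Ext.smul_comp, Abelian.Ext.mk₀_id_comp]
    exact (hz z).symm ▸ Submodule.smul_mem_smul hxm trivial
  exact (Submodule.subsingleton_iff R).1 (subsingleton_of_bot_eq_top key.symm)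

end QuotSMulTop

section Noetherian

variable {R : Type} [CommRing R] [IsNoetherianRing R]

/-- Vanishing of `Ext^i(-, X)` on a finite module follows from vanishing on `R ⧸ p` for all `p` in
the support. -/
theorem of_forall_support {X : Type} [AddCommGroup X] [Module R X] {i : ℕ} (M : Type)
    [AddCommGroup M] [Module R M] [hM : Module.Finite R M]
    (h : ∀ p ∈ Module.support R M, ExtVanishes R (R ⧸ p.asIdeal) X i) : ExtVanishes R M X i := by
  induction hM using IsNoetherianRing.induction_on_isQuotientEquivQuotientPrime with
  | subsingleton N => exact of_subsingleton_fst
  | quotient N p e =>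
    refine congr_fst e.symm (h p ?_)
    rw [e.support_eq, Module.support_eq_zeroLocus, Ideal.annihilator_quotient]
    exact fun _ hx => hx
  | exact N₁ N₂ N₃ f g hf hg hfg h₁ h₃ =>
    exact fst_middle hf hg hfg
      (h₁ fun p hp => h p (Module.support_subset_of_injective f hf hp))
      (h₃ fun p hp => h p (Module.support_subset_of_surjective g hg hp))

variable [IsLocalRing R]

theorem of_coheight_add_lt {X : Type} [AddCommGroup X] [Module R X] [Module.Finite R X] {t : ℕ}
    (hX : ∀ i < t, ExtVanishes R (R ⧸ maximalIdeal R) X i) (p : PrimeSpectrum R) (i : ℕ)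
    (hi : i + Order.coheight p < t) : ExtVanishes R (R ⧸ p.asIdeal) X i := by
  have : WellFoundedGT (PrimeSpectrum R) :=
    ⟨InvImage.wf PrimeSpectrum.asIdeal (wellFounded_gt (α := Ideal R))⟩
  induction p using WellFoundedGT.induction generalizing i with
  | ind p ih =>
  by_cases hp : p.asIdeal = maximalIdeal R
  · rw [hp]
    refine hX i ?_
    have := (self_le_add_right (i : ℕ∞) (Order.coheight p)).trans_lt hi
    exact_mod_cast this
  obtain ⟨x, hxm, hxp⟩ := SetLike.exists_of_lt
    (lt_of_le_of_ne (IsLocalRing.le_maximalIdeal p.isPrime.ne_top) hp)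
  refine of_quotSMulTop_fst (isSMulRegular_quotient_of_notMem p hxp) hxm
    (of_forall_support _ fun q hq => ?_)
  rw [Module.support_quotSMulTop] at hq
  obtain ⟨hq₁, hq₂⟩ := hq
  rw [Module.support_eq_zeroLocus, Ideal.annihilator_quotient] at hq₁
  have hxq : x ∈ q.asIdeal := hq₂ rfl
  have hpq : p < q := lt_of_le_of_ne hq₁ (by rintro rfl; exact hxp hxq)
  refine ih q hpq (i + 1) (lt_of_le_of_lt ?_ hi)
  calc ((i + 1 : ℕ) : ℕ∞) + Order.coheight q = i + (Order.coheight q + 1) := by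
        push_cast; ring
    _ ≤ _ := by gcongr; exact Order.coheight_add_one_le hpq

end Noetherian

end ExtVanishes

/-- `HasDepthGE R t T` says that `Ext^i(k, T) = 0` for all `i < t`, where `k` is the residue
field. -/
def HasDepthGE (R : Type) [CommRing R] [IsLocalRing R] (t : ℕ) (T : Type) [AddCommGroup T]
    [Module R T] : Prop :=
  ∀ i < t, ExtVanishes R (R ⧸ maximalIdeal R) T i

theorem natCast_le_moduleDepth_iff {R : Type} [CommRing R] [IsLocalRing R] {t : ℕ} {T : Type}
    [AddCommGroup T] [Module R T] : (t : ℕ∞) ≤ moduleDepth R T ↔ HasDepthGE R t T := by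
  simp only [moduleDepth, le_sInf_iff, Set.mem_ofPred_eq, forall_exists_index, and_imp, HasDepthGE,
    ← not_subsingleton_iff_nontrivial, subsingleton_extGroup_iff_s9]
  constructor
  · intro h i hi
    by_contra hne
    exact absurd (h i i rfl hne) (by exact_mod_cast not_le.2 hi)
  · rintro h _ k rfl hk
    by_contra hlt
    exact hk (h k (by exact_mod_cast not_le.1 hlt))

namespace ExtVanishes

theorem of_hasInjDimLE {R : Type} [CommRing R] {n : ℕ} {X : Type} [AddCommGroup X] [Module R X]
    (h : hasInjDimLE R n X) {i : ℕ} (hi : n < i) (T : Type) [AddCommGroup T] [Module R T] :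
    ExtVanishes R T X i := by
  induction n generalizing X i with
  | zero =>
    obtain ⟨i, rfl⟩ := Nat.exists_eq_succ_of_ne_zero hi.ne'
    have : Module.Injective R X := h
    have := Module.injective_object_of_injective_module R X
    exact Abelian.Ext.subsingleton_of_injective _ _ _
  | succ n ih =>
    obtain ⟨I, _, _, f, hI, hf, h⟩ := h
    obtain ⟨i, rfl⟩ := Nat.exists_eq_succ_of_ne_zero (Nat.ne_zero_of_lt hi)
    have := Module.injective_object_of_injective_module R I
    exact snd_left hf (Submodule.mkQ_surjective _) (LinearMap.exact_map_mkQ_range f)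
      (Abelian.Ext.subsingleton_of_injective _ _ _) (ih h (Nat.succ_lt_succ_iff.1 hi))

variable {R : Type} [CommRing R] [IsLocalRing R]

theorem _root_.HasDepthGE.quotSMulTop {T : Type} [AddCommGroup T] [Module R T]
    {t : ℕ} (h : HasDepthGE R (t + 1) T) {x : R} (hx : IsSMulRegular T x) :
    HasDepthGE R t (QuotSMulTop x T) := fun i hi =>
  quotSMulTop_snd hx (h i (Nat.lt_succ_of_lt hi)) (h (i + 1) (Nat.succ_lt_succ hi))

theorem exists_injective_of_not_zero {T : Type} [AddCommGroup T] [Module R T]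
    (h : ¬ ExtVanishes R (R ⧸ maximalIdeal R) T 0) :
    ∃ f : (R ⧸ maximalIdeal R) →ₗ[R] T, Function.Injective f := by
  rw [zero_iff, not_subsingleton_iff_nontrivial] at h
  obtain ⟨f, hf⟩ := exists_ne (0 : (R ⧸ maximalIdeal R) →ₗ[R] T)
  have : IsSimpleModule R (R ⧸ maximalIdeal R) :=
    isSimpleModule_iff_isCoatom.2 (maximalIdeal.isMaximal R).out
  exact ⟨f, LinearMap.injective_of_ne_zero hf⟩

variable [IsNoetherianRing R]

theorem _root_.HasDepthGE.exists_isSMulRegular {T : Type} [AddCommGroup T] [Module R T]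
    [Module.Finite R T] {t : ℕ} (h : HasDepthGE R (t + 1) T) :
    ∃ x ∈ maximalIdeal R, IsSMulRegular T x := by
  have := IsSMulRegular.subsingleton_linearMap_iff.1 (zero_iff.1 (h 0 t.succ_pos))
  rwa [Ideal.annihilator_quotient] at this

/-- `Ext^i(M, X) = 0` when `X` has depth at least `t` and `M` has dimension less than `t - i`. -/
theorem of_forall_support_coheight_add_lt {X : Type} [AddCommGroup X] [Module R X]
    [Module.Finite R X] {t : ℕ} (hX : HasDepthGE R t X) {M : Type} [AddCommGroup M] [Module R M]
    [Module.Finite R M] {i : ℕ} (hi : ∀ p ∈ Module.support R M, i + Order.coheight p < t) :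
    ExtVanishes R M X i :=
  of_forall_support M fun p hp => of_coheight_add_lt hX p i (hi p hp)

theorem residue_of_depth_eq {X : Type} [AddCommGroup X] [Module R X] {r : ℕ}
    (hX : ∀ (S : Type) [AddCommGroup S] [Module R S] [Module.Finite R S],
      ExtVanishes R S X (r + 1)) {t : ℕ} {T : Type} [AddCommGroup T] [Module R T]
    [Module.Finite R T] (ht : HasDepthGE R t T)
    (ht' : ¬ ExtVanishes R (R ⧸ maximalIdeal R) T t) (htr : t < r)
    (hT : ∀ i, r ≤ i + t → i ≤ r → ExtVanishes R T X i) :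
    ExtVanishes R (R ⧸ maximalIdeal R) X r := by
  induction t generalizing T with
  | zero =>
    obtain ⟨f, hf⟩ := exists_injective_of_not_zero ht'
    exact fst_left hf (Submodule.mkQ_surjective _) (LinearMap.exact_map_mkQ_range f)
      (hT r le_rfl le_rfl) (hX _)
  | succ t ih =>
    obtain ⟨x, hxm, hx⟩ := ht.exists_isSMulRegular
    refine ih (ht.quotSMulTop hx) (fun h => ht' (of_quotSMulTop_snd hx ?_ h)) (by lia) ?_
    · rwa [Ideal.annihilator_quotient]
    · intro i hi hir
      obtain ⟨i, rfl⟩ := Nat.exists_eq_succ_of_ne_zero (show i ≠ 0 by lia)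
      exact quotSMulTop_fst hx (hT _ (by lia) (by lia)) (hT _ (by lia) (by lia))

theorem descend {X : Type} [AddCommGroup X] [Module R X] [Module.Finite R X] {d : ℕ}
    (hR : HasDepthGE R d R) (hR' : ¬ ExtVanishes R (R ⧸ maximalIdeal R) R d) {r : ℕ} (hr : d < r)
    (hX : ∀ (S : Type) [AddCommGroup S] [Module R S] [Module.Finite R S],
      ExtVanishes R S X (r + 1)) (T : Type) [AddCommGroup T] [Module R T] [Module.Finite R T] :
    ExtVanishes R T X r := by
  refine of_forall_support T fun p _ => ?_
  by_cases hp : p.asIdeal = maximalIdeal R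
  · rw [hp]
    refine residue_of_depth_eq hX hR hR' hr fun i hi hir => ?_
    obtain ⟨i, rfl⟩ := Nat.exists_eq_succ_of_ne_zero (show i ≠ 0 by lia)
    exact of_projective
  · obtain ⟨x, hxm, hxp⟩ := SetLike.exists_of_lt
      (lt_of_le_of_ne (IsLocalRing.le_maximalIdeal p.isPrime.ne_top) hp)
    exact of_quotSMulTop_fst (isSMulRegular_quotient_of_notMem p hxp) hxm (hX _)

/-- Over a local ring of depth `d`, a finite module of finite injective dimension has injective
dimension at most `d`. -/
theorem of_depth_lt {X : Type} [AddCommGroup X] [Module R X] [Module.Finite R X] {d n : ℕ}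
    (hR : HasDepthGE R d R) (hR' : ¬ ExtVanishes R (R ⧸ maximalIdeal R) R d)
    (hX : hasInjDimLE R n X) {r : ℕ} (hr : d < r) (T : Type) [AddCommGroup T] [Module R T]
    [Module.Finite R T] : ExtVanishes R T X r := by
  obtain ⟨m, hm⟩ : ∃ m, n < r + m := ⟨n + 1, by lia⟩
  induction m generalizing r T with
  | zero => exact of_hasInjDimLE hX hm T
  | succ m ih => exact descend hR hR' hr (fun S => ih (by lia) S (by lia)) T

/-- Local duality for vanishing: if `ω` has injective dimension at most `d` and
`Ext^d(k, ω) ≠ 0`, then `T` has depth at least `t` iff `Ext^i(T, ω) = 0` for all `i > d - t`. -/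
theorem _root_.hasDepthGE_iff {ω : Type} [AddCommGroup ω] [Module R ω] [Module.Finite R ω] {d : ℕ}
    (hω : ∀ (S : Type) [AddCommGroup S] [Module R S] [Module.Finite R S] (i : ℕ), d < i →
      ExtVanishes R S ω i) (hω' : ¬ ExtVanishes R (R ⧸ maximalIdeal R) ω d)
    {t : ℕ} (ht : t ≤ d) {T : Type} [AddCommGroup T] [Module R T] [Module.Finite R T] :
    HasDepthGE R t T ↔ ∀ i, d < i + t → ExtVanishes R T ω i := by
  constructor
  · intro h
    clear ht
    induction t generalizing T with
    | zero => exact fun i hi => hω T i hi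
    | succ t ih =>
      intro i hi
      obtain ⟨x, hxm, hx⟩ := h.exists_isSMulRegular
      exact of_quotSMulTop_fst hx hxm (ih (h.quotSMulTop hx) (i + 1) (by lia))
  · intro h
    induction t generalizing T with
    | zero => exact fun i hi => absurd hi (Nat.not_lt_zero i)
    | succ t ih =>
      have h₀ : ExtVanishes R (R ⧸ maximalIdeal R) T 0 := by
        by_contra hne
        obtain ⟨f, hf⟩ := exists_injective_of_not_zero hne
        exact hω' (fst_left hf (Submodule.mkQ_surjective _) (LinearMap.exact_map_mkQ_range f)
          (h d (by lia)) (hω _ _ d.lt_succ_self))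
      obtain ⟨x, hxm, hx⟩ := HasDepthGE.exists_isSMulRegular (t := 0) (T := T) (R := R) (by
        intro i hi
        obtain rfl : i = 0 := by lia
        exact h₀)
      have key : HasDepthGE R t (QuotSMulTop x T) := ih (by lia) fun i hi => by
        obtain ⟨i, rfl⟩ := Nat.exists_eq_succ_of_ne_zero (show i ≠ 0 by lia)
        exact quotSMulTop_fst hx (h _ (by lia)) (h _ (by lia))
      rintro (_ | i) hi
      · exact h₀
      · refine of_quotSMulTop_snd hx ?_ (key i (by lia))
        rwa [Ideal.annihilator_quotient]

end ExtVanishes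

section MaximalCohenMacaulay

variable {R : Type} [CommRing R] [IsLocalRing R]

theorem smul_top_lt_top_of_ne_top {T : Type} [AddCommGroup T] [Module R T] [Module.Finite R T]
    [Nontrivial T] {I : Ideal R} (hI : I ≠ ⊤) : I • (⊤ : Submodule R T) < ⊤ :=
  lt_top_iff_ne_top.2 (Submodule.top_ne_ideal_smul_of_le_jacobson_annihilator
    ((IsLocalRing.le_maximalIdeal hI).trans (IsLocalRing.maximalIdeal_le_jacobson _))).symm

variable [IsNoetherianRing R]

theorem hasDepthGE_of_isRegular {T : Type} [AddCommGroup T] [Module R T] [Module.Finite R T]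
    [Nontrivial T] {rs : List R} (mem : ∀ r ∈ rs, r ∈ maximalIdeal R)
    (h : RingTheory.Sequence.IsRegular T rs) : HasDepthGE R rs.length T :=
  ModuleCat.subsingleton_ext_of_exists_isRegular (maximalIdeal R)
    (ModuleCat.of R (R ⧸ maximalIdeal R))
    (by rw [Module.support_eq_zeroLocus, Ideal.annihilator_quotient]) (ModuleCat.of R T)
    (smul_top_lt_top_of_ne_top (maximalIdeal.isMaximal R).ne_top) rs mem h

theorem exists_isRegular_of_extVanishes {T : Type} [AddCommGroup T] [Module R T]
    [Module.Finite R T] [Nontrivial T] {I : Ideal R} (hI : I ≠ ⊤) {t : ℕ}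
    (h : ∀ i < t, ExtVanishes R (R ⧸ I) T i) :
    ∃ rs : List R, rs.length = t ∧ (∀ r ∈ rs, r ∈ I) ∧ RingTheory.Sequence.IsRegular T rs :=
  ModuleCat.exists_isRegular_of_exists_subsingleton_ext I t (ModuleCat.of R T)
    (smul_top_lt_top_of_ne_top hI) (ModuleCat.of R (R ⧸ I))
    (by rw [Module.support_eq_zeroLocus, Ideal.annihilator_quotient]) h

theorem HasDepthGE.natCast_le_ringKrullDim {T : Type} [AddCommGroup T] [Module R T]
    [Module.Finite R T] [Nontrivial T] {t : ℕ} (h : HasDepthGE R t T) :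
    (t : WithBot ℕ∞) ≤ ringKrullDim R := by
  obtain ⟨q, hq⟩ := associatedPrimes.nonempty R T
  obtain ⟨hq, f, hf⟩ := (isAssociatedPrime_iff_exists_injective_linearMap q T).1 hq
  let q' : PrimeSpectrum R := ⟨q, hq⟩
  have key : (t : ℕ∞) ≤ Order.coheight q' := by
    by_contra hlt
    have := ExtVanishes.zero_iff.1
      (ExtVanishes.of_coheight_add_lt h q' 0 (by simpa using hlt))
    have hf0 : f 1 = f 0 := by rw [this.elim f 0]; simp
    exact hq.one_notMem (Ideal.Quotient.eq_zero_iff_mem.1 (hf hf0))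
  exact (WithBot.coe_le_coe.2 key).trans (Order.coheight_le_krullDim q')

theorem moduleDepth_le_ringKrullDim {T : Type} [AddCommGroup T] [Module R T]
    [Module.Finite R T] [Nontrivial T] : (moduleDepth R T : WithBot ℕ∞) ≤ ringKrullDim R := by
  obtain ⟨n, hn⟩ := WithBot.ne_bot_iff_exists.1 (ringKrullDim_ne_bot (R := R))
  rw [← hn, WithBot.coe_le_coe]
  refine ENat.forall_natCast_le_iff_le.1 fun t ht => ?_
  have := (natCast_le_moduleDepth_iff.1 ht).natCast_le_ringKrullDim
  rw [← hn] at this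
  exact WithBot.coe_le_coe.1 this

theorem moduleDepth_eq_ringKrullDim_iff {T : Type} [AddCommGroup T] [Module R T]
    [Module.Finite R T] [Nontrivial T] {d : ℕ} (hd : ringKrullDim R = d) :
    (moduleDepth R T : WithBot ℕ∞) = ringKrullDim R ↔ HasDepthGE R d T := by
  rw [← natCast_le_moduleDepth_iff, ← WithBot.coe_le_coe]
  refine ⟨fun h => ?_, fun h => le_antisymm moduleDepth_le_ringKrullDim ?_⟩
  · rw [h, hd]; rfl
  · rw [hd]; exact h

theorem HasDepthGE.of_localization {T : Type} [AddCommGroup T] [Module R T]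
    [Module.Finite R T] {t : ℕ}
    (h : HasDepthGE (Localization.AtPrime (maximalIdeal R)) t
      (LocalizedModule (maximalIdeal R).primeCompl T)) : HasDepthGE R t T := by
  cases subsingleton_or_nontrivial T with
  | inl _ => exact fun i _ => ExtVanishes.of_subsingleton_snd
  | inr _ =>
  let A := Localization.AtPrime (maximalIdeal R)
  have hunit : (maximalIdeal R).primeCompl ≤ IsUnit.submonoid R := fun x hx =>
    not_not.1 hx
  have hA : Function.Bijective (algebraMap R A) :=
    (IsLocalization.atUnits R (maximalIdeal R).primeCompl (S := A) hunit).bijective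
  have hT : Function.Bijective (LocalizedModule.mkLinearMap (maximalIdeal R).primeCompl T) := by
    refine ⟨(injective_iff_map_eq_zero _).2 fun x hx => ?_, fun y => ?_⟩
    · obtain ⟨c, hc⟩ := (IsLocalizedModule.eq_zero_iff (maximalIdeal R).primeCompl _).1 hx
      exact (hunit c.2).smul_eq_zero.1 hc
    · obtain ⟨⟨x, c⟩, hc⟩ := IsLocalizedModule.mk'_surjective (maximalIdeal R).primeCompl
        (LocalizedModule.mkLinearMap (maximalIdeal R).primeCompl T) y
      obtain ⟨u, hu⟩ := hunit c.2
      refine ⟨(↑u⁻¹ : R) • x, ?_⟩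
      rw [map_smul, ← hc]
      refine ((IsLocalizedModule.mk'_eq_iff).2 ?_).symm
      rw [Submonoid.smul_def, ← hu, smul_smul, Units.mul_inv, one_smul]
  have : Nontrivial (LocalizedModule (maximalIdeal R).primeCompl T) := hT.1.nontrivial
  obtain ⟨as, rfl, has, hreg⟩ := exists_isRegular_of_extVanishes
    (maximalIdeal.isMaximal A).ne_top h
  obtain ⟨rs, rfl⟩ : ∃ rs : List R, rs.map (algebraMap R A) = as :=
    List.map_surjective_iff.2 hA.2 as
  rw [List.length_map]
  have mem : ∀ r ∈ rs, r ∈ maximalIdeal R := fun r hr =>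
    (IsLocalization.AtPrime.to_map_mem_maximal_iff A (maximalIdeal R) r).1
      (has _ (List.mem_map_of_mem hr))
  refine hasDepthGE_of_isRegular mem
    ((IsLocalRing.isRegular_iff_isWeaklyRegular_of_subset_maximalIdeal mem).2 ?_)
  rw [(LinearEquiv.ofBijective _ hT).isWeaklyRegular_congr,
    ← RingTheory.Sequence.isWeaklyRegular_map_algebraMap_iff A]
  exact hreg.toIsWeaklyRegular

theorem HasDepthGE.localization {T : Type} [AddCommGroup T] [Module R T]
    [Module.Finite R T] {d : ℕ} (hd : ringKrullDim R = d) (h : HasDepthGE R d T)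
    (p : PrimeSpectrum R) [Nontrivial (LocalizedModule p.asIdeal.primeCompl T)] {t : ℕ}
    (ht : t ≤ Order.height p) :
    HasDepthGE (Localization.AtPrime p.asIdeal) t (LocalizedModule p.asIdeal.primeCompl T) := by
  have : Nontrivial T := by
    by_contra hT
    rw [not_nontrivial_iff_subsingleton] at hT
    exact not_subsingleton (LocalizedModule p.asIdeal.primeCompl T) inferInstance
  obtain ⟨rs, rfl, hrs, hreg⟩ := exists_isRegular_of_extVanishes (T := T) p.isPrime.ne_top
    (t := t) fun i hi => by
      refine ExtVanishes.of_coheight_add_lt h p i ?_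
      have hle : Order.height p + Order.coheight p ≤ d := by
        have := hd
        rw [ringKrullDim, Order.krullDim_eq_iSup_height_add_coheight_of_nonempty] at this
        have h2 : (⨆ a : PrimeSpectrum R, Order.height a + Order.coheight a) = d := by
          exact_mod_cast this
        rw [← h2]
        exact le_iSup (fun a : PrimeSpectrum R => Order.height a + Order.coheight a) p
      have hfin : Order.coheight p ≠ ⊤ := by
        rintro h
        rw [h] at hle
        simp at hle
      refine lt_of_lt_of_le ?_ hle
      have : (i : ℕ∞) < Order.height p := lt_of_lt_of_le (by exact_mod_cast hi) ht
      exact (ENat.add_lt_add_iff_right hfin).2 this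
  have hreg' := hreg.toIsWeaklyRegular.isRegular_of_isLocalizedModule_of_mem
    (Localization.AtPrime p.asIdeal) p.asIdeal
    (LocalizedModule.mkLinearMap p.asIdeal.primeCompl T) hrs
  rw [← rs.length_map (algebraMap R (Localization.AtPrime p.asIdeal))]
  refine hasDepthGE_of_isRegular (fun a ha => ?_) hreg'
  obtain ⟨r, hr, rfl⟩ := List.mem_map.1 ha
  exact (IsLocalization.AtPrime.to_map_mem_maximal_iff _ p.asIdeal r).2 (hrs r hr)

theorem isMCM_iff_hasDepthGE {T : Type} [AddCommGroup T] [Module R T]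
    [Module.Finite R T] {d : ℕ} (hd : ringKrullDim R = d) : IsMCM R T ↔ HasDepthGE R d T := by
  constructor
  · intro h
    cases subsingleton_or_nontrivial T with
    | inl _ => exact fun i _ => ExtVanishes.of_subsingleton_snd
    | inr _ =>
    have hm : Nontrivial (LocalizedModule (maximalIdeal R).primeCompl T) :=
      IsLocalRing.closedPoint_mem_support R T
    refine HasDepthGE.of_localization
      ((moduleDepth_eq_ringKrullDim_iff ?_).1 (h (closedPoint R) hm))
    rw [IsLocalization.AtPrime.ringKrullDim_eq_height (maximalIdeal R),
      ← hd, ← IsLocalRing.maximalIdeal_height_eq_ringKrullDim]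
  · intro h p hp
    have hle : Order.height p ≤ d := by
      have := Order.height_le_krullDim p
      rw [← ringKrullDim, hd] at this
      exact_mod_cast this
    obtain ⟨n, hn⟩ := ENat.ne_top_iff_exists.1 (ne_top_of_le_ne_top (ENat.natCast_ne_top d) hle)
    refine (moduleDepth_eq_ringKrullDim_iff (d := n) ?_).2 (h.localization hd p hn.le)
    rw [IsLocalization.AtPrime.ringKrullDim_eq_height p.asIdeal,
      PrimeSpectrum.height_eq_orderHeight, ← hn]
    rfl

end MaximalCohenMacaulay

section Tor

variable {R : Type} [CommRing R]

theorem mem_annihilator_shortComplex_homology_iff (S : ShortComplex (ModuleCat.{0} R)) (x : R) :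
    x ∈ Module.annihilator R S.homology ↔ ∀ e : S.X₂, S.g e = 0 → ∃ e', S.f e' = x • e := by
  rw [S.moduleCatHomologyIso.toLinearEquiv.annihilator_eq]
  change x ∈ Module.annihilator R (LinearMap.ker S.g.hom ⧸ LinearMap.range S.moduleCatToCycles) ↔ _
  rw [Module.mem_annihilator]
  constructor
  · intro h e he
    have := h (Submodule.Quotient.mk ⟨e, he⟩)
    rw [← Submodule.Quotient.mk_smul, Submodule.Quotient.mk_eq_zero] at this
    obtain ⟨e', he'⟩ := this
    exact ⟨e', congrArg Subtype.val he'⟩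
  · intro h y
    obtain ⟨⟨e, he⟩, rfl⟩ := Submodule.Quotient.mk_surjective _ y
    rw [← Submodule.Quotient.mk_smul, Submodule.Quotient.mk_eq_zero]
    obtain ⟨e', he'⟩ := h e he
    exact ⟨e', Subtype.ext he'⟩

variable {N : Type} [AddCommGroup N] [Module R N]

theorem mem_annihilator_torGroup_iff (P : ProjectiveResolution (ModuleCat.of R N)) {M : Type}
    [AddCommGroup M] [Module R M] (i : ℕ) (x : R) :
    x ∈ Module.annihilator R (torGroup R (i + 1) M N) ↔
      ∀ e : M ⊗[R] P.complex.X (i + 1), (P.complex.d (i + 1) i).hom.lTensor M e = 0 →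
        ∃ e' : M ⊗[R] P.complex.X (i + 2),
          (P.complex.d (i + 2) (i + 1)).hom.lTensor M e' = x • e := by
  let F := (MonoidalCategory.tensoringLeft (ModuleCat.{0} R)).obj (ModuleCat.of R M)
  let K := (F.mapHomologicalComplex (ComplexShape.down ℕ)).obj P.complex
  let e : torGroup R (i + 1) M N ≃ₗ[R] (K.sc' (i + 2) (i + 1) i).homology :=
    (P.isoLeftDerivedObj F (i + 1) ≪≫
      K.homologyIsoSc' (i + 2) (i + 1) i (by simp) (by simp)).toLinearEquiv
  rw [e.annihilator_eq, mem_annihilator_shortComplex_homology_iff]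
  rfl

theorem exact_projectiveResolution_succ (P : ProjectiveResolution (ModuleCat.of R N)) (i : ℕ) :
    Function.Exact (P.complex.d (i + 2) (i + 1)).hom (P.complex.d (i + 1) i).hom :=
  (ShortComplex.ShortExact.moduleCat_exact_iff_function_exact _).1 (P.exact_succ i)

theorem exact_projectiveResolution_zero (P : ProjectiveResolution (ModuleCat.of R N)) :
    Function.Exact (P.complex.d 1 0).hom (P.π.f 0).hom :=
  (ShortComplex.ShortExact.moduleCat_exact_iff_function_exact _).1 P.exact₀

variable {A B C : Type} [AddCommGroup A] [Module R A] [AddCommGroup B] [Module R B]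
  [AddCommGroup C] [Module R C] {f : A →ₗ[R] B} {g : B →ₗ[R] C}

theorem exists_lTensor_eq_smul_of_mem_annihilator (P : ProjectiveResolution (ModuleCat.of R N))
    (hf : Function.Injective f) (hg : Function.Surjective g) (hfg : Function.Exact f g) {i : ℕ}
    {x : R} (hx : x ∈ Module.annihilator R (torGroup R (i + 1) C N)) {c : A ⊗[R] P.complex.X i}
    {b : B ⊗[R] P.complex.X (i + 1)}
    (h : f.rTensor (P.complex.X i) c = (P.complex.d (i + 1) i).hom.lTensor B b) :
    ∃ c' : A ⊗[R] P.complex.X (i + 1),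
      (P.complex.d (i + 1) i).hom.lTensor A c' = x • c := by
  have comm {U V : Type} [AddCommGroup U] [Module R U] [AddCommGroup V] [Module R V]
      (u : U →ₗ[R] V) (j : ℕ) (z : U ⊗[R] P.complex.X (j + 1)) :
      u.rTensor (P.complex.X j) ((P.complex.d (j + 1) j).hom.lTensor U z) =
        (P.complex.d (j + 1) j).hom.lTensor V (u.rTensor (P.complex.X (j + 1)) z) := by
    rw [← LinearMap.comp_apply, ← LinearMap.comp_apply, LinearMap.rTensor_comp_lTensor,
      LinearMap.lTensor_comp_rTensor]
  have : Module.Projective R (P.complex.X i) :=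
    (IsProjective.iff_projective _).2 (P.projective i)
  have hexact (j : ℕ) := rTensor_exact (P.complex.X j) hfg hg
  obtain ⟨e, he⟩ := (mem_annihilator_torGroup_iff P i x).1 hx (g.rTensor _ b) (by
    rw [← comm, ← h, (hexact i).apply_apply_eq_zero])
  obtain ⟨e, rfl⟩ := LinearMap.rTensor_surjective (P.complex.X (i + 2)) hg e
  rw [← comm, ← map_smul, ← sub_eq_zero, ← map_sub] at he
  obtain ⟨c', hc'⟩ := (hexact (i + 1) _).1 he
  refine ⟨-c', Module.Flat.rTensor_preserves_injective_linearMap f hf ?_⟩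
  have hdd : (P.complex.d (i + 1) i).hom.lTensor B
      ((P.complex.d (i + 2) (i + 1)).hom.lTensor B e) = 0 := by
    rw [← LinearMap.comp_apply, ← LinearMap.lTensor_comp, ← ModuleCat.hom_comp,
      P.complex.d_comp_d]
    simp
  rw [comm, map_neg, map_neg, hc', map_sub, hdd, map_smul, map_smul, ← h, zero_sub, neg_neg]

theorem annihilator_torGroup_le [Module.Flat R B] (hf : Function.Injective f)
    (hg : Function.Surjective g) (hfg : Function.Exact f g) (i : ℕ) :
    Module.annihilator R (torGroup R (i + 2) C N) ≤
      Module.annihilator R (torGroup R (i + 1) A N) := by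
  intro x hx
  let P := ProjectiveResolution.of (ModuleCat.of R N)
  refine (mem_annihilator_torGroup_iff P i x).2 fun c hc => ?_
  obtain ⟨b, hb⟩ := (Module.Flat.lTensor_exact B (exact_projectiveResolution_succ P i)
    (f.rTensor _ c)).1 (by
      rw [← LinearMap.comp_apply, LinearMap.lTensor_comp_rTensor,
        ← LinearMap.rTensor_comp_lTensor, LinearMap.comp_apply, hc, map_zero])
  exact exists_lTensor_eq_smul_of_mem_annihilator P hf hg hfg hx hb.symm

theorem annihilator_torGroup_one_le (hf : Function.Injective f)
    (hg : Function.Surjective g) (hfg : Function.Exact f g) :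
    Module.annihilator R (torGroup R 1 C N) ≤
      Module.annihilator R (LinearMap.ker (f.rTensor N)) := by
  intro x hx
  let P := ProjectiveResolution.of (ModuleCat.of R N)
  have hπ : Function.Surjective (P.π.f 0).hom := (ModuleCat.epi_iff_surjective _).1 inferInstance
  rw [Module.mem_annihilator]
  rintro ⟨t, ht⟩
  obtain ⟨c, rfl⟩ := LinearMap.lTensor_surjective A hπ t
  obtain ⟨b, hb⟩ := (lTensor_exact B (exact_projectiveResolution_zero P) hπ
    (f.rTensor _ c)).1 (by
      rw [← LinearMap.comp_apply, LinearMap.lTensor_comp_rTensor,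
        ← LinearMap.rTensor_comp_lTensor, LinearMap.comp_apply]
      exact ht)
  obtain ⟨c', hc'⟩ := exists_lTensor_eq_smul_of_mem_annihilator P hf hg hfg hx hb.symm
  refine Subtype.ext ?_
  change x • (P.π.f 0).hom.lTensor A c = 0
  rw [← map_smul, ← hc']
  exact (lTensor_exact A (exact_projectiveResolution_zero P) hπ).apply_apply_eq_zero c'

end Tor

theorem coheight_le_ringKrullDim_quotient {R : Type} [CommRing R] {I : Ideal R}
    {p : PrimeSpectrum R} (h : I ≤ p.asIdeal) :
    (Order.coheight p : WithBot ℕ∞) ≤ ringKrullDim (R ⧸ I) := by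
  have : (Set.Ici p : Set (PrimeSpectrum R)) = PrimeSpectrum.zeroLocus p.asIdeal := by
    ext q
    exact Iff.rfl
  rw [Order.coheight_eq_krullDim_Ici, this, ← ringKrullDim_quotient]
  exact ringKrullDim_le_of_surjective _ (Ideal.Quotient.factor_surjective h)

theorem ringKrullDim_quotient_anti {R : Type} [CommRing R] {I J : Ideal R} (h : I ≤ J) :
    ringKrullDim (R ⧸ J) ≤ ringKrullDim (R ⧸ I) :=
  ringKrullDim_le_of_surjective _ (Ideal.Quotient.factor_surjective h)

namespace ExtVanishes

variable {R : Type} [CommRing R]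

theorem pi_fst {N X : Type} [AddCommGroup N] [Module R N] [AddCommGroup X] [Module R X] {i : ℕ}
    (h : ExtVanishes R N X i) (r : ℕ) : ExtVanishes R (Fin r → N) X i := by
  induction r with
  | zero => exact of_subsingleton_fst
  | succ r ih => exact congr_fst (Fin.consLinearEquiv R fun _ => N) (prod_fst h ih)

theorem pi_tensor_fst {N X : Type} [AddCommGroup N] [Module R N] [AddCommGroup X] [Module R X]
    {i : ℕ} (h : ExtVanishes R N X i) (r : ℕ) : ExtVanishes R ((Fin r → R) ⊗[R] N) X i :=
  congr_fst ((TensorProduct.piScalarRight R R N (Fin r)).symm ≪≫ₗ TensorProduct.comm R _ _)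
    (pi_fst h r)

/-- `Ext^i(K, X) = 0` when `X` has depth at least `t` and `K` is annihilated by an ideal `I` such
that `dim R ⧸ I < t - i`. -/
theorem of_ringKrullDim_lt [IsNoetherianRing R] [IsLocalRing R] {X : Type} [AddCommGroup X]
    [Module R X] [Module.Finite R X] {t : ℕ} (hX : HasDepthGE R t X) {K : Type} [AddCommGroup K]
    [Module R K] [Module.Finite R K] {I : Ideal R} (hI : I ≤ Module.annihilator R K) {s i : ℕ}
    (hs : ringKrullDim (R ⧸ I) < (s + 1 : ℕ)) (hi : i + s < t) : ExtVanishes R K X i := by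
  refine of_forall_support_coheight_add_lt hX fun p hp => ?_
  rw [Module.support_eq_zeroLocus] at hp
  have h := (coheight_le_ringKrullDim_quotient (hI.trans hp)).trans_lt hs
  have h' : Order.coheight p < ((s + 1 : ℕ) : ℕ∞) := WithBot.coe_lt_coe.1 h
  obtain ⟨c, hc⟩ := ENat.ne_top_iff_exists.1 h'.ne_top
  rw [← hc] at h' ⊢
  norm_cast at h' ⊢
  lia

section Tensor

variable {M' F M N ω : Type} [AddCommGroup M'] [Module R M'] [AddCommGroup F] [Module R F]
  [AddCommGroup M] [Module R M] [AddCommGroup N] [Module R N] [AddCommGroup ω] [Module R ω]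
  {f : M' →ₗ[R] F} {g : F →ₗ[R] M}

theorem exact_range_subtype_rTensor (hg : Function.Surjective g) (hfg : Function.Exact f g) :
    Function.Exact (LinearMap.range (f.rTensor N)).subtype (g.rTensor N) := by
  rw [LinearMap.exact_iff, Submodule.range_subtype, (rTensor_exact N hfg hg).linearMap_ker_eq]

theorem exact_ker_subtype_rangeRestrict {A B : Type} [AddCommGroup A] [Module R A]
    [AddCommGroup B] [Module R B] (φ : A →ₗ[R] B) :
    Function.Exact (LinearMap.ker φ).subtype φ.rangeRestrict := by
  rw [LinearMap.exact_iff, Submodule.range_subtype, LinearMap.ker_rangeRestrict]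

theorem tensor_one_iff [Module.Projective R F] (hf : Function.Injective f)
    (hg : Function.Surjective g) (hfg : Function.Exact f g)
    (hF : ExtVanishes R (F ⊗[R] N) ω 1)
    (hK : ExtVanishes R (LinearMap.ker (f.rTensor N)) ω 0) :
    ExtVanishes R (M ⊗[R] N) ω 1 ↔ ExtVanishes R M (N →ₗ[R] ω) 1 := by
  rw [one_iff (Submodule.injective_subtype _) (LinearMap.rTensor_surjective N hg)
    (exact_range_subtype_rTensor hg hfg) hF, one_iff hf hg hfg of_projective]
  constructor
  · intro h φ
    have hker : LinearMap.ker (f.rTensor N) ≤ LinearMap.ker (TensorProduct.lift φ) := by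
      intro z hz
      exact LinearMap.congr_fun ((zero_iff.1 hK).elim
        (TensorProduct.lift φ ∘ₗ (LinearMap.ker (f.rTensor N)).subtype) 0) ⟨z, hz⟩
    let φ' : LinearMap.range (f.rTensor N) →ₗ[R] ω :=
      (LinearMap.ker (f.rTensor N)).liftQ (TensorProduct.lift φ) hker ∘ₗ
        (f.rTensor N).quotKerEquivRange.symm.toLinearMap
    have hφ' (z) : φ' ((f.rTensor N).rangeRestrict z) = TensorProduct.lift φ z := by
      have : (f.rTensor N).quotKerEquivRange.symm ((f.rTensor N).rangeRestrict z) =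
          Submodule.Quotient.mk z := by
        rw [LinearEquiv.symm_apply_eq]
        rfl
      simp only [φ', LinearMap.comp_apply, LinearEquiv.coe_coe, this]
      rfl
    obtain ⟨ψ, hψ⟩ := h φ'
    refine ⟨TensorProduct.curry ψ, LinearMap.ext fun a => LinearMap.ext fun n => ?_⟩
    exact (LinearMap.congr_fun hψ ((f.rTensor N).rangeRestrict (a ⊗ₜ n))).trans
      ((hφ' _).trans (TensorProduct.lift.tmul a n))
  · intro h φ
    obtain ⟨ψ, hψ⟩ := h (TensorProduct.curry (φ ∘ₗ (f.rTensor N).rangeRestrict))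
    refine ⟨TensorProduct.lift ψ, ?_⟩
    rw [← LinearMap.cancel_right (f.rTensor N).surjective_rangeRestrict]
    refine TensorProduct.ext' fun a n => ?_
    exact LinearMap.congr_fun (LinearMap.congr_fun hψ a) n

theorem tensor_succ_iff (hg : Function.Surjective g) (hfg : Function.Exact f g) {m : ℕ}
    (hF : ∀ i, ExtVanishes R (F ⊗[R] N) ω (i + 1))
    (hK : ∀ i ≤ m + 1, ExtVanishes R (LinearMap.ker (f.rTensor N)) ω i) :
    ExtVanishes R (M ⊗[R] N) ω (m + 2) ↔ ExtVanishes R (M' ⊗[R] N) ω (m + 1) := by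
  have hK₁ := (LinearMap.ker (f.rTensor N)).injective_subtype
  have hK₂ := (f.rTensor N).surjective_rangeRestrict
  have hK₃ := exact_ker_subtype_rangeRestrict (f.rTensor N)
  have hL₁ := (LinearMap.range (f.rTensor N)).injective_subtype
  have hL₂ := LinearMap.rTensor_surjective N hg
  have hL₃ := exact_range_subtype_rTensor (N := N) hg hfg
  trans ExtVanishes R (LinearMap.range (f.rTensor N)) ω (m + 1)
  · exact ⟨fst_left hL₁ hL₂ hL₃ (hF m), fun h => fst_right hL₁ hL₂ hL₃ h (hF (m + 1))⟩
  · exact ⟨fst_middle hK₁ hK₂ hK₃ (hK _ le_rfl), fst_right hK₁ hK₂ hK₃ (hK m m.le_succ)⟩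

end Tensor

theorem ker_rTensor_of_ringKrullDim_lt [IsNoetherianRing R] [IsLocalRing R]
    {M' F M N ω : Type} [AddCommGroup M'] [Module R M'] [Module.Finite R M'] [AddCommGroup F]
    [Module R F] [AddCommGroup M] [Module R M] [AddCommGroup N] [Module R N] [Module.Finite R N]
    [AddCommGroup ω] [Module R ω] [Module.Finite R ω] {f : M' →ₗ[R] F} {g : F →ₗ[R] M}
    (hf : Function.Injective f) (hg : Function.Surjective g) (hfg : Function.Exact f g) {d s : ℕ}
    (hω : HasDepthGE R d ω)
    (hTor : ringKrullDim (R ⧸ Module.annihilator R (torGroup R 1 M N)) < (s + 1 : ℕ)) {i : ℕ}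
    (hi : i + s < d) : ExtVanishes R (LinearMap.ker (f.rTensor N)) ω i :=
  of_ringKrullDim_lt hω (annihilator_torGroup_one_le hf hg hfg) hTor hi

theorem exists_free_presentation [IsNoetherianRing R] (M : Type) [AddCommGroup M] [Module R M]
    [Module.Finite R M] :
    ∃ (r : ℕ) (M' : Type) (_ : AddCommGroup M') (_ : Module R M') (f : M' →ₗ[R] (Fin r → R))
      (g : (Fin r → R) →ₗ[R] M), Module.Finite R M' ∧ Function.Injective f ∧
        Function.Surjective g ∧ Function.Exact f g := by
  obtain ⟨r, g, hg⟩ := Module.Finite.exists_fin' R M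
  exact ⟨r, LinearMap.ker g, inferInstance, inferInstance, (LinearMap.ker g).subtype, g,
    inferInstance, (LinearMap.ker g).injective_subtype, hg, LinearMap.exact_subtype_ker_map g⟩

/-- If `dim Tor_i(M, N) < i + s` in degrees `1 ≤ i ≤ d - s`, then `Ext^n(M ⊗ N, ω)` and
`Ext^n(M, Hom(N, ω))` vanish simultaneously for `1 ≤ n ≤ d - s`. -/
theorem tensor_iff_hom [IsNoetherianRing R] [IsLocalRing R] {N ω : Type} [AddCommGroup N]
    [Module R N] [Module.Finite R N] [AddCommGroup ω] [Module R ω] [Module.Finite R ω] {d : ℕ}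
    (hω : HasDepthGE R d ω) (hN : ∀ i, ExtVanishes R N ω (i + 1)) {n s : ℕ} (hns : n + 1 + s ≤ d)
    {M : Type} [AddCommGroup M] [Module R M] [Module.Finite R M]
    (hTor : ∀ i, i + 1 + s ≤ d →
      ringKrullDim (R ⧸ Module.annihilator R (torGroup R (i + 1) M N)) < (i + s + 1 : ℕ)) :
    ExtVanishes R (M ⊗[R] N) ω (n + 1) ↔ ExtVanishes R M (N →ₗ[R] ω) (n + 1) := by
  induction n generalizing s M with
  | zero =>
    obtain ⟨r, M', _, _, f, g, _, hf, hg, hfg⟩ := exists_free_presentation (R := R) M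
    exact tensor_one_iff hf hg hfg (pi_tensor_fst (hN 0) r)
      (ker_rTensor_of_ringKrullDim_lt (s := s) hf hg hfg hω (by simpa using hTor 0 (by lia))
        (by lia))
  | succ n ih =>
    obtain ⟨r, M', _, _, f, g, _, hf, hg, hfg⟩ := exists_free_presentation (R := R) M
    rw [tensor_succ_iff hg hfg (fun i => pi_tensor_fst (hN i) r) fun i hi =>
        ker_rTensor_of_ringKrullDim_lt (s := s) hf hg hfg hω (by simpa using hTor 0 (by lia))
          (by lia),
      ih (s := s + 1) (by lia) fun i hi =>
        (ringKrullDim_quotient_anti (annihilator_torGroup_le hf hg hfg i)).trans_lt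
          (lt_of_lt_of_eq (hTor (i + 1) (by lia)) (by congr 1; lia))]
    exact ⟨fun h => fst_right hf hg hfg h of_projective, fst_left hf hg hfg of_projective⟩

end ExtVanishes

/-- If `N` is MCM and `dim Tor_i(M, N) < i` for `1 ≤ i ≤ d`, then `M ⊗ N` is MCM iff
`Ext^i(M, Hom(N, ω)) = 0` for `1 ≤ i ≤ d`. -/
theorem tensor_mcm_iff_ext_dual_vanishing (R : Type) [CommRing R] [IsNoetherianRing R]
    [IsLocalRing R] (d : ℕ) (hd : ringKrullDim R = d) (hCM : IsCMLocal R)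
    (ω : Type) [AddCommGroup ω] [Module R ω] (hω : IsCanonicalModule R ω)
    (M N : Type) [AddCommGroup M] [Module R M] [Module.Finite R M]
    [AddCommGroup N] [Module R N] [Module.Finite R N]
    (hN : IsMCM R N)
    (htor : ∀ i : ℕ, 1 ≤ i → i ≤ d →
      ringKrullDim (R ⧸ Module.annihilator R (torGroup R i M N)) < (i : WithBot ℕ∞)) :
    IsMCM R (TensorProduct R M N) ↔
      ∀ i : ℕ, 1 ≤ i → i ≤ d → Subsingleton (extGroup R i M (N →ₗ[R] ω)) := by
  obtain ⟨hωfin, hωMCM, ⟨n, hinj⟩, d', hd', ⟨e⟩⟩ := hω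
  obtain rfl : d = d' := by
    rw [hd] at hd'
    exact_mod_cast hd'
  have hdepth : moduleDepth R R = d := by
    rw [IsCMLocal, hd] at hCM
    exact WithBot.coe_injective hCM
  have hR : HasDepthGE R d R := natCast_le_moduleDepth_iff.1 hdepth.ge
  have hR' : ¬ ExtVanishes R (R ⧸ maximalIdeal R) R d := fun h => by
    have h' : ((d + 1 : ℕ) : ℕ∞) ≤ moduleDepth R R := natCast_le_moduleDepth_iff.2 fun i hi => by
      obtain hi | rfl := Nat.lt_succ_iff_lt_or_eq.1 hi
      exacts [hR i hi, h]
    rw [hdepth] at h'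
    exact absurd h' (by exact_mod_cast d.lt_succ_self.not_ge)
  have hω' : ¬ ExtVanishes R (R ⧸ maximalIdeal R) ω d := by
    rw [← subsingleton_extGroup_iff_s9, e.toEquiv.subsingleton_congr,
      not_subsingleton_iff_nontrivial]
    infer_instance
  have duality {T : Type} [AddCommGroup T] [Module R T] [Module.Finite R T] :
      IsMCM R T ↔ ∀ i, d < i + d → ExtVanishes R T ω i :=
    (isMCM_iff_hasDepthGE hd).trans (hasDepthGE_iff
      (fun S _ _ _ i hi => ExtVanishes.of_depth_lt hR hR' hinj hi S) hω' le_rfl)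
  have hNω (i : ℕ) : ExtVanishes R N ω (i + 1) := duality.1 hN _ (by lia)
  have key {i : ℕ} (hi : i + 1 ≤ d) :
      ExtVanishes R (M ⊗[R] N) ω (i + 1) ↔ ExtVanishes R M (N →ₗ[R] ω) (i + 1) :=
    ExtVanishes.tensor_iff_hom (s := 0) ((isMCM_iff_hasDepthGE hd).1 hωMCM) hNω hi
      fun j hj => htor (j + 1) (by lia) hj
  simp only [subsingleton_extGroup_iff_s9]
  rw [duality]
  constructor
  · rintro h (_ | i) hi hid
    · lia
    · exact (key hid).1 (h _ (by lia))
  · rintro h (_ | i) hi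
    · lia
    · by_cases hid : i + 1 ≤ d
      · exact (key hid).2 (h _ (by lia) hid)
      · exact ExtVanishes.of_depth_lt hR hR' hinj (by lia) _
end
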